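/- Let N ≥ 3 and assume p_c < p_f < p_S. Then there exist ρ₀ > 0, ε > 0 and C > 0 such that for all α, β > 0 with α + β < ε there exists a function η ∈ C²([ρ₀,∞)) with η(ρ₀) = α and η'(ρ₀) = β which solves η''(ρ) + a·η'(ρ) + b·η(ρ) + I(ρ) + L₁(ρ)η(ρ) + L₂(ρ)η'(ρ) + N[η](ρ) = 0 for all ρ ≥ ρ₀, and which satisfies |η(ρ)| + |η'(ρ)| ≤ C·( Q(ρ,ρ₀) + ∫_{ρ₀}^{ρ} Q(ρ,τ)|I(τ)| dτ ) for all ρ ≥ ρ₀. -/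

import Mathlib

/-- The exponent `p_* = 1 + 4/(N−4+2√(N−1))`. -/
noncomputable def pStar (N : ℕ) : ℝ :=
  1 + 4 / ((N : ℝ) - 4 + 2 * Real.sqrt ((N : ℝ) - 1))

/-- The smaller positive number `λ₁` with `−λ₁` a root of `λ² + aλ + b = 0`
(when the roots are real), i.e. `λ₁ = (a − √(a²−4b))/2`. -/
noncomputable def lamOneRoot (a b : ℝ) : ℝ :=
  (a - Real.sqrt (a ^ 2 - 4 * b)) / 2

/-- The comparison kernel `Q(ρ,τ)` for `ρ ≥ τ`: `e^{−λ₁(ρ−τ)}` if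
`p_c < p_f < p_*`; `(1+(ρ−τ))e^{−λ_*(ρ−τ)}` with `λ_* = a/2` if `p_f = p_*`;
`e^{−(a/2)(ρ−τ)}` if `p_* < p_f < p_S`. -/
noncomputable def Qker (N : ℕ) (pf a b ρ τ : ℝ) : ℝ :=
  if pf < pStar N then Real.exp (-(lamOneRoot a b) * (ρ - τ))
  else if pf = pStar N then (1 + (ρ - τ)) * Real.exp (-(a / 2) * (ρ - τ))
  else Real.exp (-(a / 2) * (ρ - τ))

section TransformedEquation

open Set Filter Topology

lemma norm_le_of_linear_ode {ν : ℂ} {t₀ : ℝ} {z g : ℝ → ℂ} {X X' : ℝ → ℝ}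
    (hz : ∀ t ∈ Ici t₀, HasDerivWithinAt z (g t - ν * z t) (Ici t₀) t)
    (hX : ∀ t ∈ Ici t₀, HasDerivWithinAt X (X' t) (Ici t₀) t)
    (h0 : ‖z t₀‖ ≤ X t₀) (hb : ∀ t ≥ t₀, ‖g t‖ ≤ X' t + ν.re * X t) :
    ∀ t ≥ t₀, ‖z t‖ ≤ X t := by
  intro t ht
  have hexp : ∀ s : ℝ, HasDerivAt (fun s : ℝ => Complex.exp (ν * s))
      (Complex.exp (ν * s) * ν) s := fun s => by
    simpa using ((Complex.ofRealCLM.hasDerivAt (x := s)).const_mul ν).cexp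
  have hrexp : ∀ s : ℝ, HasDerivAt (fun s : ℝ => Real.exp (ν.re * s))
      (Real.exp (ν.re * s) * ν.re) s := fun s => by
    simpa using ((hasDerivAt_id s).const_mul ν.re).exp
  have hnorm : ∀ s : ℝ, ‖Complex.exp (ν * s)‖ = Real.exp (ν.re * s) := fun s => by
    simp [Complex.norm_exp]
  have hf : ∀ s ∈ Ici t₀, HasDerivWithinAt (fun s : ℝ => Complex.exp (ν * s) * z s)
      (Complex.exp (ν * s) * g s) (Ici t₀) s := fun s hs => by
    refine ((hexp s).hasDerivWithinAt.mul (hz s hs)).congr_deriv ?_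
    ring
  have hB : ∀ s ∈ Ici t₀, HasDerivWithinAt (fun s : ℝ => Real.exp (ν.re * s) * X s)
      (Real.exp (ν.re * s) * (X' s + ν.re * X s)) (Ici t₀) s := fun s hs => by
    refine ((hrexp s).hasDerivWithinAt.mul (hX s hs)).congr_deriv ?_
    ring
  have key := image_norm_le_of_norm_deriv_right_le_deriv_boundary' (a := t₀) (b := t)
    (fun s hs => ((hf s hs.1).continuousWithinAt).mono Icc_subset_Ici_self)
    (fun s hs => (hf s hs.1).mono (Ici_subset_Ici.2 hs.1))
    (by rw [norm_mul, hnorm]; gcongr)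
    (fun s hs => ((hB s hs.1).continuousWithinAt).mono Icc_subset_Ici_self)
    (fun s hs => (hB s hs.1).mono (Ici_subset_Ici.2 hs.1))
    (fun s hs => by rw [norm_mul, hnorm]; gcongr; exact hb s hs.1)
    (right_mem_Icc.2 ht)
  rw [norm_mul, hnorm] at key
  exact le_of_mul_le_mul_left key (Real.exp_pos _)

lemma nonneg_of_linear_ode {lam t₀ : ℝ} {y y' : ℝ → ℝ}
    (hy : ∀ t ∈ Ici t₀, HasDerivWithinAt y (y' t) (Ici t₀) t) (h0 : 0 ≤ y t₀)
    (hb : ∀ t ≥ t₀, 0 ≤ y' t + lam * y t) : ∀ t ≥ t₀, 0 ≤ y t := fun t ht => by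
  simpa using norm_le_of_linear_ode (ν := lam) (z := fun _ => 0) (g := fun _ => 0)
    (fun s _ => by simpa using hasDerivWithinAt_const s (Ici t₀) (0 : ℂ)) hy (by simpa)
    (by simpa using hb) t ht

lemma abs_le_of_linear_ode {mu t₀ : ℝ} {y g X X' : ℝ → ℝ}
    (hy : ∀ t ∈ Ici t₀, HasDerivWithinAt y (g t - mu * y t) (Ici t₀) t)
    (hX : ∀ t ∈ Ici t₀, HasDerivWithinAt X (X' t) (Ici t₀) t)
    (h0 : |y t₀| ≤ X t₀) (hb : ∀ t ≥ t₀, |g t| ≤ X' t + mu * X t) :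
    ∀ t ≥ t₀, |y t| ≤ X t := fun t ht => by
  simpa using norm_le_of_linear_ode (ν := mu) (z := fun s => (y s : ℂ))
    (g := fun s => (g s : ℂ))
    (fun s hs => by simpa using (hy s hs).ofReal_comp) hX (by simpa) (by simpa using hb) t ht

/-- A globally Lipschitz, bounded-at-zero ODE has a global forward solution. -/
lemma exists_forward_solution {E : Type*} [NormedAddCommGroup E] [NormedSpace ℝ E]
    [CompleteSpace E] {V : ℝ → E → E} {K C t₀ : ℝ} (hV : Continuous (Function.uncurry V))
    (hK : 0 ≤ K) (hC : 0 ≤ C) (hlip : ∀ t ≥ t₀, ∀ x y, ‖V t x - V t y‖ ≤ K * ‖x - y‖)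
    (h0 : ∀ t ≥ t₀, ‖V t 0‖ ≤ C) (x₀ : E) :
    ∃ u : ℝ → E, u t₀ = x₀ ∧ Continuous u ∧ ∀ t ≥ t₀, HasDerivAt u (V t (u t)) t := by
  set L : ℝ := 2 * K + 1 with hL
  have hLpos : 0 < L := by positivity
  have hexpInt : ∀ c τ : ℝ, ∫ s in t₀..τ, c * Real.exp (L * (s - t₀)) =
      c * (Real.exp (L * (τ - t₀)) - 1) / L := fun c τ => by
    have : ∀ s ∈ uIcc t₀ τ, HasDerivAt (fun s => c * Real.exp (L * (s - t₀)) / L)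
        (c * Real.exp (L * (s - t₀))) s := fun s _ => by
      have h1 : HasDerivAt (fun s => L * (s - t₀)) L s := by
        simpa using ((hasDerivAt_id s).sub_const t₀).const_mul L
      refine (((h1.exp).const_mul c).div_const L).congr_deriv ?_
      field_simp
    rw [intervalIntegral.integral_eq_sub_of_hasDerivAt this
      ((by fun_prop : Continuous _).intervalIntegrable _ _)]
    simp; ring
  let w : BoundedContinuousFunction ℝ E → ℝ → E :=
    fun z s => V s (Real.exp (L * (s - t₀)) • z s)
  have hwc : ∀ z, Continuous (w z) := fun z =>
    hV.comp (continuous_id.prodMk ((by fun_prop : Continuous fun s : ℝ =>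
      Real.exp (L * (s - t₀))).smul z.continuous))
  have hint : ∀ z τ, IntervalIntegrable (w z) MeasureTheory.volume t₀ τ :=
    fun z τ => (hwc z).intervalIntegrable _ _
  let P : BoundedContinuousFunction ℝ E → ℝ → E := fun z τ => x₀ + ∫ s in t₀..τ, w z s
  have hPd : ∀ z τ, HasDerivAt (P z) (w z τ) τ := fun z τ =>
    (intervalIntegral.integral_hasDerivAt_right (hint z τ)
      ((hwc z).stronglyMeasurableAtFilter _ _) (hwc z).continuousAt).const_add x₀
  have hPc : ∀ z, Continuous (P z) := fun z =>
    continuous_iff_continuousAt.2 fun τ => (hPd z τ).continuousAt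
  have hone : ∀ s, t₀ ≤ s → 1 ≤ Real.exp (L * (s - t₀)) := fun s hs =>
    Real.one_le_exp (mul_nonneg hLpos.le (sub_nonneg.2 hs))
  have hwb : ∀ z s, t₀ ≤ s → ‖w z s‖ ≤ (C + K * ‖z‖) * Real.exp (L * (s - t₀)) := by
    intro z s hs
    have h1 := hlip s hs (Real.exp (L * (s - t₀)) • z s) 0
    rw [sub_zero, norm_smul, Real.norm_of_nonneg (Real.exp_pos _).le] at h1
    have h2 : ‖w z s‖ ≤ ‖V s (Real.exp (L * (s - t₀)) • z s) - V s 0‖ + ‖V s 0‖ := by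
      simpa using norm_add_le (V s (Real.exp (L * (s - t₀)) • z s) - V s 0) (V s 0)
    have h3 := z.norm_coe_le_norm s
    calc ‖w z s‖ ≤ K * (Real.exp (L * (s - t₀)) * ‖z‖) + C * Real.exp (L * (s - t₀)) := by
          have h4 : C ≤ C * Real.exp (L * (s - t₀)) := le_mul_of_one_le_right hC (hone s hs)
          have h5 : K * (Real.exp (L * (s - t₀)) * ‖z s‖) ≤
              K * (Real.exp (L * (s - t₀)) * ‖z‖) := by gcongr
          linarith [h0 s hs]
      _ = _ := by ring
  have hwl : ∀ z z' s, t₀ ≤ s →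
      ‖w z s - w z' s‖ ≤ (K * dist z z') * Real.exp (L * (s - t₀)) := by
    intro z z' s hs
    refine (hlip s hs _ _).trans ?_
    rw [← smul_sub, norm_smul, Real.norm_of_nonneg (Real.exp_pos _).le, ← dist_eq_norm]
    have := z.dist_coe_le_dist (g := z') s
    calc K * (Real.exp (L * (s - t₀)) * dist (z s) (z' s))
        ≤ K * (Real.exp (L * (s - t₀)) * dist z z') := by gcongr
      _ = _ := by ring
  have hbnd : ∀ (g : ℝ → E) (c τ : ℝ), 0 ≤ c → t₀ ≤ τ →
      (∀ s, t₀ ≤ s → ‖g s‖ ≤ c * Real.exp (L * (s - t₀))) →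
      ‖Real.exp (-(L * (τ - t₀))) • ∫ s in t₀..τ, g s‖ ≤ c / L := by
    intro g c τ hc hτ hg
    rw [norm_smul, Real.norm_of_nonneg (Real.exp_pos _).le]
    have h1 : ‖∫ s in t₀..τ, g s‖ ≤ ∫ s in t₀..τ, c * Real.exp (L * (s - t₀)) :=
      intervalIntegral.norm_integral_le_of_norm_le hτ
        (Eventually.of_forall fun s hs => hg s hs.1.le)
        ((by fun_prop : Continuous _).intervalIntegrable _ _)
    rw [hexpInt] at h1
    calc _ ≤ Real.exp (-(L * (τ - t₀))) * (c * (Real.exp (L * (τ - t₀)) - 1) / L) := by gcongr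
      _ ≤ Real.exp (-(L * (τ - t₀))) * (c * (Real.exp (L * (τ - t₀))) / L) := by
          gcongr; linarith
      _ = c / L := by rw [Real.exp_neg]; field_simp
  let T : BoundedContinuousFunction ℝ E → BoundedContinuousFunction ℝ E := fun z =>
    BoundedContinuousFunction.ofNormedAddCommGroup
      (fun t => Real.exp (-(L * (max t t₀ - t₀))) • P z (max t t₀))
      (by have := hPc z; fun_prop) (‖x₀‖ + (C + K * ‖z‖) / L) (fun t => by
        have hm : t₀ ≤ max t t₀ := le_max_right _ _
        rw [smul_add]
        refine (norm_add_le _ _).trans (add_le_add ?_ ?_)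
        · rw [norm_smul, Real.norm_of_nonneg (Real.exp_pos _).le]
          refine mul_le_of_le_one_left (norm_nonneg _) (Real.exp_le_one_iff.2 ?_)
          have := mul_nonneg hLpos.le (sub_nonneg.2 hm)
          linarith
        · exact hbnd _ _ _ (by positivity) hm (hwb z))
  have hcontr : ContractingWith (1 / 2 : NNReal) T := by
    refine ⟨by rw [← NNReal.coe_lt_coe]; norm_num, LipschitzWith.of_dist_le_mul fun z z' => ?_⟩
    refine (BoundedContinuousFunction.dist_le (by positivity)).2 fun t => ?_
    have hm : t₀ ≤ max t t₀ := le_max_right _ _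
    have h1 := hbnd (fun s => w z s - w z' s) _ _ (by positivity) hm (hwl z z')
    rw [intervalIntegral.integral_sub (hint _ _) (hint _ _)] at h1
    have h2 : T z t - T z' t = Real.exp (-(L * (max t t₀ - t₀))) •
        ((∫ s in t₀..max t t₀, w z s) - ∫ s in t₀..max t t₀, w z' s) := by
      change Real.exp _ • P z _ - Real.exp _ • P z' _ = _
      rw [← smul_sub]; simp [P]
    rw [dist_eq_norm, h2]
    refine h1.trans ?_
    rw [div_le_iff₀ hLpos]
    have : (0 : ℝ) ≤ dist z z' := dist_nonneg
    push_cast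
    nlinarith
  obtain ⟨z, hz⟩ : ∃ z, T z = z := ⟨_, hcontr.fixedPoint_isFixedPt⟩
  refine ⟨P z, by simp [P], hPc z, fun t ht => ?_⟩
  have h1 : z t = Real.exp (-(L * (t - t₀))) • P z t := by
    conv_lhs => rw [← hz]
    change Real.exp (-(L * (max t t₀ - t₀))) • P z (max t t₀) = _
    rw [max_eq_left ht]
  have h2 : w z t = V t (P z t) := by
    simp only [w]
    rw [h1, smul_smul, ← Real.exp_add]; simp
  exact h2 ▸ hPd z t

/-- The linear operator `η'' + aη' + bη` maps forcing terms dominated by the defect of a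
supersolution `X ≤ 2v` to solutions dominated by `M w`. -/
def LinearBound (a b lam θ M : ℝ) : Prop :=
  ∀ (t₀ δ : ℝ) (p v w X X' η η' g : ℝ → ℝ),
    (∀ t ≥ t₀, 0 ≤ p t) → (∀ t ≥ t₀, 0 ≤ v t) → (∀ t ≥ t₀, v t ≤ w t) → δ ≤ w t₀ →
    (∀ t ∈ Ici t₀, HasDerivWithinAt w (-lam * w t + θ * v t + p t) (Ici t₀) t) →
    (∀ t ∈ Ici t₀, HasDerivWithinAt X (X' t) (Ici t₀) t) →
    (∀ t ≥ t₀, |g t| ≤ X' t + lam * X t) → (∀ t ≥ t₀, X t ≤ 2 * v t) → δ ≤ X t₀ →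
    M * (|η t₀| + |η' t₀|) ≤ δ →
    (∀ t ∈ Ici t₀, HasDerivWithinAt η (η' t) (Ici t₀) t) →
    (∀ t ∈ Ici t₀, HasDerivWithinAt η' (g t - a * η' t - b * η t) (Ici t₀) t) →
    ∀ t ≥ t₀, |η t| + |η' t| ≤ M * w t

lemma linearBound_of_real_roots {a b lam θ mu : ℝ} (hlam : 0 < lam) (hmu : lam ≤ mu)
    (hpos : 0 < mu - lam + θ) (ha : mu + lam = a) (hb : mu * lam = b) :
    ∃ M, 0 < M ∧ LinearBound a b lam θ M := by
  set c : ℝ := 2 / (mu - lam + θ) + 2 with hc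
  have hc2 : 2 ≤ c := by have : 0 < 2 / (mu - lam + θ) := by positivity
                         linarith
  have hcm : 2 ≤ c * (mu - lam + θ) := by
    rw [hc, add_mul, div_mul_cancel₀ _ hpos.ne']; linarith
  have hmu0 : 0 < mu := hlam.trans_le hmu
  refine ⟨c + mu * c + 2, by positivity, ?_⟩
  intro t₀ δ p v w X X' η η' g hp hv hvw hδw hw hX hgX hXv hδX h0 hη hη'
  have hn1 := abs_nonneg (η t₀)
  have hn2 := abs_nonneg (η' t₀)
  have hx : ∀ t ≥ t₀, |η' t + mu * η t| ≤ X t := by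
    refine abs_le_of_linear_ode (mu := lam) (g := g) (fun t ht => ?_) hX ?_ hgX
    · refine ((hη' t ht).add ((hη t ht).const_mul mu)).congr_deriv ?_
      rw [← ha, ← hb]; ring
    · refine le_trans ?_ hδX
      refine (abs_add_le _ _).trans ?_
      rw [abs_mul, abs_of_pos hmu0]
      nlinarith [mul_nonneg hmu0.le hn2, mul_nonneg hmu0.le hn1]
  have hηw : ∀ t ≥ t₀, |η t| ≤ c * w t := by
    refine abs_le_of_linear_ode (mu := mu) (g := fun t => η' t + mu * η t) (fun t ht => ?_)
      (fun t ht => (hw t ht).const_mul c) ?_ (fun t ht => ?_)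
    · exact (hη t ht).congr_deriv (by ring)
    · have h1 : 0 ≤ (c + mu * c) * (|η t₀| + |η' t₀|) := by positivity
      have h2 : 1 * w t₀ ≤ c * w t₀ :=
        mul_le_mul_of_nonneg_right (by linarith) ((hv t₀ le_rfl).trans (hvw t₀ le_rfl))
      linarith
    · refine (hx t ht).trans ((hXv t ht).trans ?_)
      have h1 := hv t ht
      have h2 := mul_nonneg (sub_nonneg.2 hmu) (sub_nonneg.2 (hvw t ht))
      have h3 := mul_nonneg (by linarith : 0 ≤ c) h2
      have h4 := mul_nonneg (by linarith : 0 ≤ c) (hp t ht)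
      have h5 := mul_le_mul_of_nonneg_right hcm h1
      nlinarith
  intro t ht
  have h1 := hηw t ht
  have h2 : |η' t| ≤ |η' t + mu * η t| + mu * |η t| := by
    have := abs_sub (η' t + mu * η t) (mu * η t)
    rwa [add_sub_cancel_right, abs_mul mu, abs_of_pos hmu0] at this
  have h3 := mul_le_mul_of_nonneg_left h1 hmu0.le
  linarith [hx t ht, hXv t ht, hvw t ht]

lemma linearBound_of_complex_roots {a b θ : ℝ} (ha : 0 < a) (hab : a ^ 2 < 4 * b) :
    ∃ M, 0 < M ∧ LinearBound a b (a / 2) θ M := by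
  set om : ℝ := Real.sqrt (b - a ^ 2 / 4) with hom
  have hom0 : 0 < om := Real.sqrt_pos.2 (by linarith)
  have homsq : om ^ 2 = b - a ^ 2 / 4 := Real.sq_sqrt (by linarith)
  set c : ℝ := 2 / om with hc
  have hc0 : 0 < c := by positivity
  have hcom : c * om = 2 := by rw [hc]; field_simp
  refine ⟨c + a / 2 * c + 2 + a + om, by positivity, ?_⟩
  intro t₀ δ p v w X X' η η' g hp hv hvw hδw hw hX hgX hXv hδX h0 hη hη'
  have hn1 := abs_nonneg (η t₀)
  have hn2 := abs_nonneg (η' t₀)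
  let mu : ℂ := ⟨a / 2, om⟩
  let nu : ℂ := ⟨a / 2, -om⟩
  have hz : ∀ t ≥ t₀, ‖(η' t : ℂ) + mu * (η t : ℂ)‖ ≤ X t := by
    refine norm_le_of_linear_ode (ν := nu) (g := fun t => (g t : ℂ)) (fun t ht => ?_) hX ?_ ?_
    · refine ((hη' t ht).ofReal_comp.add ((hη t ht).ofReal_comp.const_mul mu)).congr_deriv ?_
      apply Complex.ext <;> simp [mu, nu]
      · linear_combination η t * homsq
      · ring
    · refine le_trans ?_ hδX
      refine (norm_add_le _ _).trans ?_
      have hmun : ‖mu‖ ≤ a / 2 + om := by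
        refine (Complex.norm_le_abs_re_add_abs_im mu).trans (le_of_eq ?_)
        simp [mu, abs_of_pos hom0]; positivity
      rw [norm_mul, Complex.norm_real, Complex.norm_real, Real.norm_eq_abs, Real.norm_eq_abs]
      have h1 := mul_le_mul_of_nonneg_right hmun hn1
      have h2 : 0 ≤ (c + a / 2 * c) * (|η t₀| + |η' t₀|) := by positivity
      have h3 : 0 ≤ (a + om) * |η' t₀| := by positivity
      have h4 : 0 ≤ a * |η t₀| := by positivity
      nlinarith
    · simpa [nu] using hgX
  intro t ht
  have hb := (hz t ht).trans ((hXv t ht).trans (mul_le_mul_of_nonneg_left (hvw t ht) zero_le_two))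
  have hre := (Complex.abs_re_le_norm _).trans hb
  have him := (Complex.abs_im_le_norm _).trans hb
  simp only [mu, Complex.add_re, Complex.mul_re, Complex.add_im, Complex.mul_im,
    Complex.ofReal_re, Complex.ofReal_im, mul_zero, sub_zero, zero_add] at hre him
  rw [abs_mul, abs_of_pos hom0] at him
  have h1 : |η t| ≤ c * w t := by
    have : om * |η t| ≤ om * (c * w t) :=
      him.trans (le_of_eq (by linear_combination -(w t) * hcom))
    exact le_of_mul_le_mul_left this hom0
  have h2 : |η' t| ≤ |η' t + a / 2 * η t| + a / 2 * |η t| := by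
    have := abs_sub (η' t + a / 2 * η t) (a / 2 * η t)
    rwa [add_sub_cancel_right, abs_mul (a / 2), abs_of_pos (by positivity : 0 < a / 2)] at this
  have h3 := mul_le_mul_of_nonneg_left h1 (by positivity : 0 ≤ a / 2)
  have h4 : 0 ≤ (a + om) * w t := by
    have := (hv t ht).trans (hvw t ht)
    positivity
  linarith

/-- Variation of constants: the kernel `(1 + θ(ρ-τ)) e^{-λ(ρ-τ)}` is generated by a triangular
linear system. -/
lemma exists_kernel_system (lam θ δ t₀ : ℝ) {p : ℝ → ℝ} (hp : Continuous p) :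
    ∃ v w : ℝ → ℝ, v t₀ = δ ∧ w t₀ = δ ∧
      (∀ t, HasDerivAt v (-lam * v t + p t) t) ∧
      (∀ t, HasDerivAt w (-lam * w t + θ * v t + p t) t) ∧
      ∀ t, w t = δ * ((1 + θ * (t - t₀)) * Real.exp (-lam * (t - t₀))) +
        ∫ τ in t₀..t, (1 + θ * (t - τ)) * Real.exp (-lam * (t - τ)) * p τ := by
  have hftc : ∀ k : ℝ → ℝ, Continuous k → ∀ t, HasDerivAt (fun t => ∫ τ in t₀..t, k τ) (k t) t :=
    fun k hk t => intervalIntegral.integral_hasDerivAt_right (hk.intervalIntegrable _ _)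
      (hk.stronglyMeasurableAtFilter _ _) hk.continuousAt
  set k₀ : ℝ → ℝ := fun τ => Real.exp (lam * (τ - t₀)) * p τ with hk₀
  set k₁ : ℝ → ℝ := fun τ => (τ - t₀) * Real.exp (lam * (τ - t₀)) * p τ with hk₁
  have hk₀c : Continuous k₀ := by fun_prop
  have hk₁c : Continuous k₁ := by fun_prop
  have hE : ∀ t, HasDerivAt (fun t => Real.exp (-lam * (t - t₀)))
      (Real.exp (-lam * (t - t₀)) * (-lam)) t := fun t => by
    have h1 : HasDerivAt (fun s => -lam * (s - t₀)) (-lam) t := by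
      simpa using ((hasDerivAt_id t).sub_const t₀).const_mul (-lam)
    exact h1.exp
  have hEk : ∀ t, Real.exp (-lam * (t - t₀)) * Real.exp (lam * (t - t₀)) = 1 := fun t => by
    rw [← Real.exp_add]; simp
  set v : ℝ → ℝ := fun t => Real.exp (-lam * (t - t₀)) * (δ + ∫ τ in t₀..t, k₀ τ) with hvdef
  have hv : ∀ t, HasDerivAt v (-lam * v t + p t) t := fun t => by
    refine ((hE t).mul ((hftc k₀ hk₀c t).const_add δ)).congr_deriv ?_
    simp only [hvdef, hk₀]
    linear_combination p t * hEk t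
  refine ⟨v, fun t => (1 + θ * (t - t₀)) * v t -
    θ * (Real.exp (-lam * (t - t₀)) * ∫ τ in t₀..t, k₁ τ), by simp [hvdef], by simp [hvdef],
    hv, fun t => ?_, fun t => ?_⟩
  · have h1 : HasDerivAt (fun t => 1 + θ * (t - t₀)) θ t := by
      simpa using (((hasDerivAt_id t).sub_const t₀).const_mul θ).const_add 1
    refine ((h1.mul (hv t)).sub (((hE t).mul (hftc k₁ hk₁c t)).const_mul θ)).congr_deriv ?_
    simp only [hk₁]
    linear_combination (-θ * (t - t₀) * p t) * hEk t
  · have h2 : ∀ τ, (1 + θ * (t - τ)) * Real.exp (-lam * (t - τ)) * p τ =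
        (1 + θ * (t - t₀)) * Real.exp (-lam * (t - t₀)) * k₀ τ -
          θ * Real.exp (-lam * (t - t₀)) * k₁ τ := fun τ => by
      have : Real.exp (-lam * (t - τ)) =
          Real.exp (-lam * (t - t₀)) * Real.exp (lam * (τ - t₀)) := by
        rw [← Real.exp_add]; congr 1; ring
      simp only [hk₀, hk₁, this]; ring
    simp_rw [h2]
    rw [intervalIntegral.integral_sub ((hk₀c.const_mul _).intervalIntegrable _ _)
      ((hk₁c.const_mul _).intervalIntegrable _ _), intervalIntegral.integral_const_mul,
      intervalIntegral.integral_const_mul]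
    simp only [hvdef]; ring

/-- A supersolution for the quadratic comparison problem, bounded by `2v`. -/
lemma exists_supersolution {lam κ K θ : ℝ} (hlam : 0 < lam) (hκ : 0 < κ) (hK : 0 < K)
    (hθ1 : θ ≤ 1) :
    ∃ σ > 0, ∀ (t₀ : ℝ) (p v w H : ℝ → ℝ), (∀ t ≥ t₀, 0 ≤ p t) →
      (∀ t ≥ t₀, 0 ≤ v t) → (∀ t ≥ t₀, v t ≤ w t) → (∀ t ≥ t₀, w t ≤ σ) →
      (∀ t ≥ t₀, 0 ≤ H t) → (∀ t ≥ t₀, H t ≤ σ) → v t₀ = w t₀ →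
      (∀ t, HasDerivAt v (-lam * v t + p t) t) →
      (∀ t, HasDerivAt w (-lam * w t + θ * v t + p t) t) →
      (∀ t, HasDerivAt H (-κ * H t + p t) t) →
      ∃ X X' : ℝ → ℝ, (∀ t, HasDerivAt X (X' t) t) ∧ (∀ t ≥ t₀, X t ≤ 2 * v t) ∧
        v t₀ ≤ X t₀ ∧
        ∀ t ≥ t₀, p t + K * (p t + H t) * w t + K * w t ^ 2 ≤ X' t + lam * X t := by
  set A : ℝ := K / lam with hA
  set A₂ : ℝ := 2 * A / lam with hA₂
  set A₃ : ℝ := A₂ / lam with hA₃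
  set D : ℝ := K / κ with hD
  set D₂ : ℝ := D / κ with hD₂
  have hA0 : 0 < A := by positivity
  have hA20 : 0 < A₂ := by positivity
  have hA30 : 0 < A₃ := by positivity
  have hD0 : 0 < D := by positivity
  have hD20 : 0 < D₂ := by positivity
  have eA : A * lam = K := div_mul_cancel₀ _ hlam.ne'
  have eA2 : A₂ * lam = 2 * A := div_mul_cancel₀ _ hlam.ne'
  have eA3 : A₃ * lam = A₂ := div_mul_cancel₀ _ hlam.ne'
  have eD : D * κ = K := div_mul_cancel₀ _ hκ.ne'
  have eD2 : D₂ * κ = D := div_mul_cancel₀ _ hκ.ne'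
  set S : ℝ := 2 * A + 2 * A₂ + 2 * A₃ + 2 * D + 2 * D₂ + K with hS
  have hS0 : 0 < S := by positivity
  refine ⟨1 / S, by positivity, ?_⟩
  intro t₀ p v w H hp hv hvw hwσ hH hHσ hvw0 hdv hdw hdH
  have hsS : 1 / S * S = 1 := div_mul_cancel₀ _ hS0.ne'
  set σ : ℝ := 1 / S
  refine ⟨fun t => 2 * v t - (A * (w t * w t) + A₂ * (v t * w t) + A₃ * (v t * v t) +
    D * (H t * w t) + D₂ * (H t * v t)), _, fun t =>
      ((hdv t).const_mul 2).sub
        ((((((hdw t).mul (hdw t)).const_mul A).add (((hdv t).mul (hdw t)).const_mul A₂)).add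
        (((hdv t).mul (hdv t)).const_mul A₃)).add (((hdH t).mul (hdw t)).const_mul D) |>.add
        (((hdH t).mul (hdv t)).const_mul D₂)), fun t ht => ?_, ?_, fun t ht => ?_⟩
  · have h1 := hv t ht
    have h2 := h1.trans (hvw t ht)
    have h3 := hH t ht
    have : 0 ≤ A * (w t * w t) + A₂ * (v t * w t) + A₃ * (v t * v t) +
      D * (H t * w t) + D₂ * (H t * v t) := by positivity
    linarith
  · have h1 := hv t₀ le_rfl
    have h2 := hwσ t₀ le_rfl
    have h3 := hHσ t₀ le_rfl
    simp only [← hvw0] at h2 ⊢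
    have e1 := mul_le_mul_of_nonneg_left (mul_le_mul_of_nonneg_left h2 h1)
      (by positivity : 0 ≤ A + A₂ + A₃)
    have e2 := mul_le_mul_of_nonneg_left (mul_le_mul_of_nonneg_left h3 h1)
      (by positivity : 0 ≤ D + D₂)
    have hσ0 : 0 ≤ σ := h1.trans h2
    have e3 : 0 ≤ v t₀ * σ * (A + A₂ + A₃ + D + D₂ + K) := by positivity
    have e4 : v t₀ * (σ * S) = v t₀ := by rw [hsS, mul_one]
    rw [hS] at e4
    nlinarith
  · have h1 := hv t ht
    have h12 := hvw t ht
    have h2 := h1.trans h12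
    have h3 := hH t ht
    have hpt := hp t ht
    have e1 : 0 ≤ A * (1 - θ) * (v t * w t) :=
      mul_nonneg (mul_nonneg hA0.le (sub_nonneg.2 hθ1)) (mul_nonneg h1 h2)
    have e2 : 0 ≤ A₂ * (1 - θ) * (v t * v t) :=
      mul_nonneg (mul_nonneg hA20.le (sub_nonneg.2 hθ1)) (mul_nonneg h1 h1)
    have e3 : 0 ≤ D * (1 - θ) * (H t * v t) :=
      mul_nonneg (mul_nonneg hD0.le (sub_nonneg.2 hθ1)) (mul_nonneg h3 h1)
    have e4 : p t * (2 * A * w t + A₂ * (v t + w t) + 2 * A₃ * v t + D * (H t + w t) +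
        D₂ * (H t + v t) + K * w t) ≤ p t := by
      have hw' := hwσ t ht
      have hv' := h12.trans hw'
      have hH' := hHσ t ht
      have : 2 * A * w t + A₂ * (v t + w t) + 2 * A₃ * v t + D * (H t + w t) +
        D₂ * (H t + v t) + K * w t ≤ 2 * A * σ + A₂ * (σ + σ) + 2 * A₃ * σ + D * (σ + σ) +
        D₂ * (σ + σ) + K * σ := by gcongr
      have h5 : 2 * A * σ + A₂ * (σ + σ) + 2 * A₃ * σ + D * (σ + σ) +
        D₂ * (σ + σ) + K * σ = 1 := by rw [← hsS, hS]; ring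
      exact mul_le_of_le_one_right hpt (this.trans_eq h5)
    linear_combination e4 + 2 * e1 + e2 + e3 - (w t * w t) * eA - (v t * w t) * eA2
      - (v t * v t) * eA3 - (H t * w t) * eD - (H t * v t) * eD2

lemma abs_le_of_integrating_factor {t₀ : ℝ} {h H H' E k r : ℝ → ℝ}
    (hE0 : ∀ t ≥ t₀, 0 < E t)
    (hE : ∀ t ∈ Ici t₀, HasDerivWithinAt E (k t * E t) (Ici t₀) t)
    (hh : ∀ t ∈ Ici t₀, HasDerivWithinAt h (r t - k t * h t) (Ici t₀) t)
    (hH : ∀ t ∈ Ici t₀, HasDerivWithinAt H (H' t) (Ici t₀) t)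
    (h0 : |h t₀| ≤ H t₀) (hb : ∀ t ≥ t₀, |r t| ≤ H' t + k t * H t) :
    ∀ t ≥ t₀, |h t| ≤ H t := by
  intro t ht
  have hf : ∀ s ∈ Ici t₀, HasDerivWithinAt (fun s => E s * h s) (E s * r s) (Ici t₀) s :=
    fun s hs => ((hE s hs).mul (hh s hs)).congr_deriv (by ring)
  have hB : ∀ s ∈ Ici t₀, HasDerivWithinAt (fun s => E s * H s)
      (E s * (H' s + k s * H s)) (Ici t₀) s :=
    fun s hs => ((hE s hs).mul (hH s hs)).congr_deriv (by ring)
  have key := image_norm_le_of_norm_deriv_right_le_deriv_boundary' (a := t₀) (b := t)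
    (fun s hs => ((hf s hs.1).continuousWithinAt).mono Icc_subset_Ici_self)
    (fun s hs => (hf s hs.1).mono (Ici_subset_Ici.2 hs.1))
    (by
      rw [norm_mul, Real.norm_of_nonneg (hE0 _ le_rfl).le]
      exact mul_le_mul_of_nonneg_left h0 (hE0 _ le_rfl).le)
    (fun s hs => ((hB s hs.1).continuousWithinAt).mono Icc_subset_Ici_self)
    (fun s hs => (hB s hs.1).mono (Ici_subset_Ici.2 hs.1))
    (fun s hs => by
      rw [norm_mul, Real.norm_of_nonneg (hE0 _ hs.1).le]
      exact mul_le_mul_of_nonneg_left (hb s hs.1) (hE0 _ hs.1).le)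
    (right_mem_Icc.2 ht)
  rw [norm_mul, Real.norm_of_nonneg (hE0 _ ht).le] at key
  exact le_of_mul_le_mul_left key (hE0 _ ht)

lemma le_of_linear_ode {lam t₀ c : ℝ} {y r : ℝ → ℝ}
    (hy : ∀ t, HasDerivAt y (-lam * y t + r t) t) (h0 : y t₀ ≤ c)
    (hr : ∀ t ≥ t₀, r t ≤ lam * c) : ∀ t ≥ t₀, y t ≤ c := fun t ht => by
  have := nonneg_of_linear_ode (lam := lam) (y := fun s => c - y s)
    (fun s _ => ((hy s).const_sub c).hasDerivWithinAt) (sub_nonneg.2 h0)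
    (fun s hs => by have := hr s hs; nlinarith) t ht
  linarith

lemma abs_clamp_le {B x : ℝ} (hB : 0 ≤ B) : |max (-B) (min x B)| ≤ B :=
  abs_le.2 ⟨le_max_left _ _, max_le (by linarith) (min_le_right _ _)⟩

lemma clamp_eq_self {B x : ℝ} (hx : |x| ≤ B) : max (-B) (min x B) = x := by
  rw [min_eq_left (abs_le.1 hx).2, max_eq_right (abs_le.1 hx).1]

lemma abs_clamp_sub_clamp_le (B x y : ℝ) :
    |max (-B) (min x B) - max (-B) (min y B)| ≤ |x - y| := by
  refine (abs_max_sub_max_le_max _ _ _ _).trans ?_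
  rw [sub_self, abs_zero, max_eq_right (abs_nonneg _)]
  refine (abs_min_sub_min_le_max _ _ _ _).trans ?_
  rw [sub_self, abs_zero, max_eq_left (abs_nonneg _)]

/-- Small solutions of a perturbed second-order equation, dominated by the linear kernel.
The coefficients `L₁, L₂` are only controlled by the forcing `I` and by a quantity `h` which
itself relaxes exponentially under the forcing `I`. -/
theorem exists_small_solution {a b lam κ K θ M : ℝ} (hlam : 0 < lam) (hκ : 0 < κ) (hK : 0 < K)
    (hθ0 : 0 ≤ θ) (hθ1 : θ ≤ 1) (hM : 0 < M) (hlin : LinearBound a b lam θ M) :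
    ∃ σ > 0, ∀ (t₀ : ℝ) (I L₁ L₂ h k E : ℝ → ℝ) (Nl : ℝ → ℝ → ℝ),
      Continuous I → Continuous L₁ → Continuous L₂ → Continuous (Function.uncurry Nl) →
      (∀ t ≥ t₀, |I t| ≤ σ) → |h t₀| ≤ σ →
      (∀ t ≥ t₀, 0 < E t) → (∀ t ≥ t₀, κ ≤ k t) →
      (∀ t ∈ Ici t₀, HasDerivWithinAt E (k t * E t) (Ici t₀) t) →
      (∀ t ∈ Ici t₀, HasDerivWithinAt h (I t / 2 - k t * h t) (Ici t₀) t) →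
      (∀ t ≥ t₀, |L₁ t| ≤ K * (|I t| + |h t|)) →
      (∀ t ≥ t₀, |L₂ t| ≤ K * (|I t| + |h t|)) →
      (∀ t ≥ t₀, ∀ s, |s| ≤ 1 / 2 → |Nl t s| ≤ K * s ^ 2) →
      (∀ t ≥ t₀, ∀ s s', |Nl t s - Nl t s'| ≤ K * |s - s'|) →
      ∀ α β : ℝ, M * (|α| + |β|) ≤ σ → ∃ η η' : ℝ → ℝ, Continuous η ∧ Continuous η' ∧
        η t₀ = α ∧ η' t₀ = β ∧ (∀ t ≥ t₀, |η t| ≤ 1 / 2) ∧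
        (∀ t ≥ t₀, HasDerivAt η (η' t) t) ∧
        (∀ t ≥ t₀, HasDerivAt η' (-(a * η' t + b * η t + I t + L₁ t * η t + L₂ t * η' t +
          Nl t (η t))) t) ∧
        ∀ t ≥ t₀, |η t| + |η' t| ≤ M * (1 + σ) *
          ((1 + θ * (t - t₀)) * Real.exp (-lam * (t - t₀)) +
            ∫ τ in t₀..t, (1 + θ * (t - τ)) * Real.exp (-lam * (t - τ)) * |I τ|) := by
  set K' : ℝ := 2 * K * M + K * M ^ 2 with hK'
  obtain ⟨σs, hσs, hsup⟩ := exists_supersolution (lam := lam) (κ := κ) (K := K') (θ := θ)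
    hlam hκ (by positivity) hθ1
  set σ₁ : ℝ := min σs (1 / (2 * M)) with hσ₁
  have hσ₁0 : 0 < σ₁ := lt_min hσs (by positivity)
  set S : ℝ := 1 + 1 / κ + 1 / lam + (2 + 1 / lam) / lam with hS
  have hS0 : 0 < S := by positivity
  set σ : ℝ := σ₁ / S with hσ
  have hσ0 : 0 < σ := by positivity
  have hσS : σ * S = σ₁ := div_mul_cancel₀ _ hS0.ne'
  refine ⟨σ, hσ0, ?_⟩
  intro t₀ I L₁ L₂ h k E Nl hI hL₁ hL₂ hN hIσ hhσ hE0 hk hE hh hL₁b hL₂b hNq hNl α β hαβ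
  set p : ℝ → ℝ := fun t => |I t| with hp
  have hpc : Continuous p := hI.abs
  have hp0 : ∀ t, 0 ≤ p t := fun t => abs_nonneg _
  obtain ⟨v, w, hv0, hw0, hdv, hdw, hwf⟩ := exists_kernel_system lam θ σ t₀ hpc
  obtain ⟨H, -, hH0, -, hdH, -, -⟩ := exists_kernel_system κ 0 σ t₀ hpc
  have hvn : ∀ t ≥ t₀, 0 ≤ v t := nonneg_of_linear_ode (lam := lam)
    (fun t _ => (hdv t).hasDerivWithinAt) (hv0 ▸ hσ0.le) (fun t _ => by linarith [hp0 t])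
  have hHn : ∀ t ≥ t₀, 0 ≤ H t := nonneg_of_linear_ode (lam := κ)
    (fun t _ => (hdH t).hasDerivWithinAt) (hH0 ▸ hσ0.le) (fun t _ => by linarith [hp0 t])
  have hvw : ∀ t ≥ t₀, v t ≤ w t := fun t ht => by
    have := nonneg_of_linear_ode (lam := lam) (y := fun t => w t - v t)
      (fun t _ => ((hdw t).sub (hdv t)).hasDerivWithinAt) (by simp [hv0, hw0])
      (fun t ht => by linarith [mul_nonneg hθ0 (hvn t ht)]) t ht
    linarith
  have hvb : ∀ t ≥ t₀, v t ≤ σ * (1 + 1 / lam) := by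
    refine le_of_linear_ode hdv ?_ (fun t ht => (hIσ t ht).trans ?_)
    · rw [hv0]; exact le_mul_of_one_le_right hσ0.le (by linarith [one_div_pos.2 hlam])
    · have : lam * (σ * (1 + 1 / lam)) = lam * σ + σ := by field_simp
      nlinarith
  have hwb : ∀ t ≥ t₀, w t ≤ σ₁ := by
    have hle : σ * (1 + (2 + 1 / lam) / lam) ≤ σ₁ := by
      rw [← hσS]
      refine mul_le_mul_of_nonneg_left ?_ hσ0.le
      linarith [one_div_pos.2 hlam, one_div_pos.2 hκ]
    have := le_of_linear_ode (lam := lam) (r := fun t => θ * v t + p t) (t₀ := t₀)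
      (c := σ * (1 + (2 + 1 / lam) / lam))
      (fun t => (hdw t).congr_deriv (by ring)) ?_ (fun t ht => ?_)
    · exact fun t ht => (this t ht).trans hle
    · rw [hw0]
      refine le_mul_of_one_le_right hσ0.le ?_
      have : 0 < (2 + 1 / lam) / lam := by positivity
      linarith
    · have e : lam * (σ * (1 + (2 + 1 / lam) / lam)) = lam * σ + σ + σ * (1 + 1 / lam) := by
        field_simp; ring
      have h1 := hvb t ht
      have h2 := mul_le_mul_of_nonneg_right hθ1 (hvn t ht)
      have h3 : p t ≤ σ := hIσ t ht
      have h4 : 0 < lam * σ := by positivity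
      simp only [e]
      linarith
  have hHb : ∀ t ≥ t₀, H t ≤ σ₁ := by
    have hle : σ * (1 + 1 / κ) ≤ σ₁ := by
      rw [← hσS]
      refine mul_le_mul_of_nonneg_left ?_ hσ0.le
      have : 0 < (2 + 1 / lam) / lam := by positivity
      linarith [one_div_pos.2 hlam]
    refine fun t ht => (le_of_linear_ode hdH ?_ (fun t ht => (hIσ t ht).trans ?_) t ht).trans hle
    · rw [hH0]; exact le_mul_of_one_le_right hσ0.le (by linarith [one_div_pos.2 hκ])
    · have : κ * (σ * (1 + 1 / κ)) = κ * σ + σ := by field_simp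
      nlinarith
  have hhH : ∀ t ≥ t₀, |h t| ≤ H t :=
    abs_le_of_integrating_factor hE0 hE hh (fun t _ => (hdH t).hasDerivWithinAt)
      (hH0 ▸ hhσ) (fun t ht => by
        have h1 := mul_nonneg (sub_nonneg.2 (hk t ht)) (hHn t ht)
        have h2 := hp0 t
        rw [abs_div, abs_two]
        change p t / 2 ≤ _
        linarith)
  obtain ⟨X, X', hdX, hXv, hvX, hX⟩ := hsup t₀ p v w H (fun t _ => hp0 t) hvn hvw
    (fun t ht => (hwb t ht).trans (min_le_left _ _)) hHn
    (fun t ht => (hHb t ht).trans (min_le_left _ _)) (hv0.trans hw0.symm) hdv hdw hdH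
  have hwc : Continuous w := continuous_iff_continuousAt.2 fun t => (hdw t).continuousAt
  have hwn : ∀ t ≥ t₀, 0 ≤ w t := fun t ht => (hvn t ht).trans (hvw t ht)
  have hMw : ∀ t ≥ t₀, 0 ≤ M * w t := fun t ht => mul_nonneg hM.le (hwn t ht)
  have hMw2 : ∀ t ≥ t₀, M * w t ≤ 1 / 2 := fun t ht => by
    have h1 := mul_le_mul_of_nonneg_left ((hwb t ht).trans (min_le_right _ _)) hM.le
    have h2 : M * (1 / (2 * M)) = 1 / 2 := by field_simp
    linarith
  let cl : ℝ → ℝ → ℝ := fun t x => max (-(M * w t)) (min x (M * w t))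
  let G : ℝ → ℝ × ℝ → ℝ := fun t u =>
    I t + L₁ t * cl t u.1 + L₂ t * cl t u.2 + Nl t (cl t u.1)
  let V : ℝ → ℝ × ℝ → ℝ × ℝ := fun t u => (u.2, -a * u.2 - b * u.1 - G t u)
  have hVc : Continuous (Function.uncurry V) := by
    have hcl1 : Continuous fun x : ℝ × (ℝ × ℝ) => cl x.1 x.2.1 := by fun_prop
    have hcl2 : Continuous fun x : ℝ × (ℝ × ℝ) => cl x.1 x.2.2 := by fun_prop
    have hNc : Continuous fun x : ℝ × (ℝ × ℝ) => Nl x.1 (cl x.1 x.2.1) :=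
      hN.comp (continuous_fst.prodMk hcl1)
    change Continuous fun x : ℝ × (ℝ × ℝ) => (x.2.2, -a * x.2.2 - b * x.2.1 -
      (I x.1 + L₁ x.1 * cl x.1 x.2.1 + L₂ x.1 * cl x.1 x.2.2 + Nl x.1 (cl x.1 x.2.1)))
    fun_prop
  set Lb : ℝ := K * (σ + σ₁) with hLb
  have hL : ∀ t ≥ t₀, K * (|I t| + |h t|) ≤ Lb := fun t ht =>
    mul_le_mul_of_nonneg_left (add_le_add (hIσ t ht) ((hhH t ht).trans (hHb t ht))) hK.le
  have hclip : ∀ t x y, |cl t x - cl t y| ≤ |x - y| := fun t x y => abs_clamp_sub_clamp_le _ x y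
  obtain ⟨u, hu0, huc, hu⟩ := exists_forward_solution (V := V) (t₀ := t₀)
    (K := 1 + |a| + |b| + 2 * Lb + K) (C := σ) hVc (by positivity) hσ0.le (fun t ht x y => by
      have hx1 : |x.1 - y.1| ≤ ‖x - y‖ := norm_fst_le (x - y)
      have hx2 : |x.2 - y.2| ≤ ‖x - y‖ := norm_snd_le (x - y)
      have hn : 0 ≤ ‖x - y‖ := norm_nonneg _
      refine norm_prod_le_iff.2 ⟨?_, ?_⟩
      · change |x.2 - y.2| ≤ _
        have : 0 ≤ (|a| + |b| + 2 * Lb + K) * ‖x - y‖ := by positivity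
        linarith
      · change |(-a * x.2 - b * x.1 - G t x) - (-a * y.2 - b * y.1 - G t y)| ≤ _
        have e : (-a * x.2 - b * x.1 - G t x) - (-a * y.2 - b * y.1 - G t y) =
          -(a * (x.2 - y.2) + b * (x.1 - y.1) + L₁ t * (cl t x.1 - cl t y.1) +
            L₂ t * (cl t x.2 - cl t y.2) + (Nl t (cl t x.1) - Nl t (cl t y.1))) := by
          simp only [G]; ring
        rw [e, abs_neg]
        have h1 : |a * (x.2 - y.2)| ≤ |a| * ‖x - y‖ := by rw [abs_mul]; gcongr
        have h2 : |b * (x.1 - y.1)| ≤ |b| * ‖x - y‖ := by rw [abs_mul]; gcongr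
        have h3 : |L₁ t * (cl t x.1 - cl t y.1)| ≤ Lb * ‖x - y‖ := by
          rw [abs_mul]
          exact mul_le_mul ((hL₁b t ht).trans (hL t ht)) ((hclip _ _ _).trans hx1)
            (abs_nonneg _) (by positivity)
        have h4 : |L₂ t * (cl t x.2 - cl t y.2)| ≤ Lb * ‖x - y‖ := by
          rw [abs_mul]
          exact mul_le_mul ((hL₂b t ht).trans (hL t ht)) ((hclip _ _ _).trans hx2)
            (abs_nonneg _) (by positivity)
        have h5 : |Nl t (cl t x.1) - Nl t (cl t y.1)| ≤ K * ‖x - y‖ :=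
          (hNl t ht _ _).trans (mul_le_mul_of_nonneg_left ((hclip _ _ _).trans hx1) hK.le)
        refine (abs_add_le _ _).trans ?_
        have h6 := abs_add_three (a * (x.2 - y.2) + b * (x.1 - y.1))
          (L₁ t * (cl t x.1 - cl t y.1)) (L₂ t * (cl t x.2 - cl t y.2))
        have h7 := abs_add_le (a * (x.2 - y.2)) (b * (x.1 - y.1))
        linarith)
    (fun t ht => by
      have hcl0 : cl t 0 = 0 := clamp_eq_self (by simpa using hMw t ht)
      have hN0 : Nl t 0 = 0 := by simpa using hNq t ht 0 (by norm_num)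
      refine norm_prod_le_iff.2 ⟨by simpa [V] using hσ0.le, ?_⟩
      simpa [V, G, hcl0, hN0] using hIσ t ht) (α, β)
  have hη : ∀ t ≥ t₀, HasDerivAt (fun t => (u t).1) (u t).2 t := fun t ht =>
    (hu t ht).fst
  have hη' : ∀ t ≥ t₀, HasDerivAt (fun t => (u t).2)
      (-a * (u t).2 - b * (u t).1 - G t (u t)) t := fun t ht => (hu t ht).snd
  have hmain : ∀ t ≥ t₀, |(u t).1| + |(u t).2| ≤ M * w t := by
    refine hlin t₀ σ p v w X X' _ _ (fun t => -G t (u t)) (fun t _ => hp0 t) hvn hvw hw0.ge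
      (fun t _ => (hdw t).hasDerivWithinAt) (fun t _ => (hdX t).hasDerivWithinAt)
      (fun t ht => ?_) hXv (hv0 ▸ hvX) (by simpa [hu0] using hαβ)
      (fun t ht => (hη t ht).hasDerivWithinAt)
      (fun t ht => ((hη' t ht).congr_deriv (by ring)).hasDerivWithinAt)
    refine le_trans ?_ (hX t ht)
    rw [abs_neg]
    have c1 : |cl t (u t).1| ≤ M * w t := abs_clamp_le (hMw t ht)
    have c2 : |cl t (u t).2| ≤ M * w t := abs_clamp_le (hMw t ht)
    have hph : K * (|I t| + |h t|) ≤ K * (p t + H t) :=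
      mul_le_mul_of_nonneg_left (add_le_add le_rfl (hhH t ht)) hK.le
    have hnn : 0 ≤ K * (p t + H t) := mul_nonneg hK.le (add_nonneg (hp0 t) (hHn t ht))
    have h1 : |L₁ t * cl t (u t).1| ≤ K * (p t + H t) * (M * w t) := by
      rw [abs_mul]; exact mul_le_mul ((hL₁b t ht).trans hph) c1 (abs_nonneg _) hnn
    have h2 : |L₂ t * cl t (u t).2| ≤ K * (p t + H t) * (M * w t) := by
      rw [abs_mul]; exact mul_le_mul ((hL₂b t ht).trans hph) c2 (abs_nonneg _) hnn
    have h3 : |Nl t (cl t (u t).1)| ≤ K * (M * w t) ^ 2 := by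
      refine (hNq t ht _ (c1.trans (hMw2 t ht))).trans (mul_le_mul_of_nonneg_left ?_ hK.le)
      exact sq_le_sq' (by linarith [(abs_le.1 c1).1]) (abs_le.1 c1).2
    have h4 : |G t (u t)| ≤ p t + |L₁ t * cl t (u t).1| + |L₂ t * cl t (u t).2| +
        |Nl t (cl t (u t).1)| :=
      (abs_add_le _ _).trans (add_le_add_left (abs_add_three _ _ _) _)
    have h5 : 0 ≤ K * M ^ 2 * (p t + H t) * w t :=
      mul_nonneg (mul_nonneg (by positivity) (add_nonneg (hp0 t) (hHn t ht))) (hwn t ht)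
    have h6 : 0 ≤ 2 * K * M * w t ^ 2 := by positivity
    refine h4.trans ?_
    rw [hK']
    linarith
  have hb1 : ∀ t ≥ t₀, |(u t).1| ≤ M * w t := fun t ht => by
    linarith [hmain t ht, abs_nonneg (u t).2]
  have hb2 : ∀ t ≥ t₀, |(u t).2| ≤ M * w t := fun t ht => by
    linarith [hmain t ht, abs_nonneg (u t).1]
  refine ⟨fun t => (u t).1, fun t => (u t).2, by fun_prop, by fun_prop, by simp [hu0],
    by simp [hu0], fun t ht => (hb1 t ht).trans (hMw2 t ht), hη, fun t ht => ?_, fun t ht => ?_⟩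
  · have e1 : cl t (u t).1 = (u t).1 := clamp_eq_self (hb1 t ht)
    have e2 : cl t (u t).2 = (u t).2 := clamp_eq_self (hb2 t ht)
    refine (hη' t ht).congr_deriv ?_
    simp only [G, e1, e2]
    ring
  · refine (hmain t ht).trans ?_
    rw [hwf t, mul_assoc]
    refine mul_le_mul_of_nonneg_left ?_ hM.le
    have hQ : ∀ τ ≤ t, 0 ≤ (1 + θ * (t - τ)) * Real.exp (-lam * (t - τ)) := fun τ hτ => by
      have := mul_nonneg hθ0 (sub_nonneg.2 hτ)
      positivity
    have hint : 0 ≤ ∫ τ in t₀..t, (1 + θ * (t - τ)) * Real.exp (-lam * (t - τ)) * p τ :=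
      intervalIntegral.integral_nonneg ht fun τ hτ => mul_nonneg (hQ τ hτ.2) (hp0 τ)
    have h1 := hQ t₀ ht
    have h2 := mul_nonneg hσ0.le hint
    simp only [hp] at hint h2 ⊢
    linarith

lemma tendsto_div_id_of_deriv_tendsto_zero {G G' : ℝ → ℝ}
    (hG : ∀ s > 0, HasDerivAt G (G' s) s) (hG' : Tendsto G' atTop (𝓝 0)) :
    Tendsto (fun s => G s / s) atTop (𝓝 0) := by
  rw [Metric.tendsto_nhds]
  intro ε hε
  obtain ⟨S, hS⟩ := eventually_atTop.1
    ((Metric.tendsto_nhds.1 hG' (ε / 2) (half_pos hε)).and (eventually_ge_atTop 1))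
  have hS1 : 1 ≤ S := (hS S le_rfl).2
  filter_upwards [eventually_ge_atTop S, eventually_gt_atTop (2 * |G S| / ε)] with s hs hs'
  have hs0 : 0 < s := by linarith
  have h1 : ‖G s - G S‖ ≤ ε / 2 * ‖s - S‖ :=
    (convex_Ici S).norm_image_sub_le_of_norm_hasDerivWithin_le
      (fun x hx => (hG x (zero_lt_one.trans_le (hS x hx).2)).hasDerivWithinAt)
      (fun x hx => by simpa using (hS x hx).1.le) self_mem_Ici hs
  rw [Real.norm_eq_abs, Real.norm_of_nonneg (sub_nonneg.2 hs)] at h1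
  rw [div_lt_iff₀ hε] at hs'
  rw [dist_zero_right, norm_div, Real.norm_eq_abs, Real.norm_of_nonneg hs0.le, div_lt_iff₀ hs0]
  have h2 : |G s| ≤ |G s - G S| + |G S| := by simpa using abs_add_le (G s - G S) (G S)
  have h3 : 0 < ε / 2 * S := by positivity
  nlinarith

section Nonlinearity

variable {f F : ℝ → ℝ} {q : ℝ}

lemma hasDerivAt_tail (hfc : ContinuousOn f (Ioi 0)) (hfpos : ∀ s : ℝ, 0 < s → 0 < f s)
    (hfint : ∀ s : ℝ, 0 < s → MeasureTheory.IntegrableOn (fun t => (f t)⁻¹) (Ioi s))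
    (hF : ∀ s : ℝ, F s = ∫ t in Ioi s, (f t)⁻¹) {s : ℝ} (hs : 0 < s) :
    HasDerivAt F (-(f s)⁻¹) s := by
  have hinv : ContinuousOn (fun t => (f t)⁻¹) (Ioi 0) := hfc.inv₀ fun x hx => (hfpos x hx).ne'
  have hs2 : 0 < s / 2 := half_pos hs
  have hsub : uIcc (s / 2) s ⊆ Ioi 0 := by
    rw [uIcc_of_le (by linarith)]; exact fun x hx => hs2.trans_le hx.1
  have h1 : HasDerivAt (fun x => ∫ t in (s / 2)..x, (f t)⁻¹) (f s)⁻¹ s :=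
    intervalIntegral.integral_hasDerivAt_right (hinv.mono hsub).intervalIntegrable
      (hinv.stronglyMeasurableAtFilter isOpen_Ioi s hs) (hinv.continuousAt (Ioi_mem_nhds hs))
  refine (h1.const_sub (F (s / 2))).congr_of_eventuallyEq ?_
  filter_upwards [Ioi_mem_nhds hs] with x hx
  rw [← intervalIntegral.integral_Ioi_sub_Ioi' (hfint _ hs2) (hfint _ hx), hF, hF]
  ring

lemma tail_pos (hfc : ContinuousOn f (Ioi 0)) (hfpos : ∀ s : ℝ, 0 < s → 0 < f s)
    (hfint : ∀ s : ℝ, 0 < s → MeasureTheory.IntegrableOn (fun t => (f t)⁻¹) (Ioi s))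
    (hF : ∀ s : ℝ, F s = ∫ t in Ioi s, (f t)⁻¹) {s : ℝ} (hs : 0 < s) : 0 < F s := by
  have hinv : ContinuousOn (fun t => (f t)⁻¹) (Ioi 0) := hfc.inv₀ fun x hx => (hfpos x hx).ne'
  have hsub : uIcc s (s + 1) ⊆ Ioi 0 := by
    rw [uIcc_of_le (by linarith)]; exact fun x hx => hs.trans_le hx.1
  have h1 : 0 < ∫ t in s..(s + 1), (f t)⁻¹ :=
    intervalIntegral.intervalIntegral_pos_of_pos_on (hinv.mono hsub).intervalIntegrable
      (fun x hx => inv_pos.2 (hfpos x (hs.trans hx.1))) (by linarith)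
  rw [← intervalIntegral.integral_Ioi_sub_Ioi (hfint s hs) (by linarith), ← hF, ← hF] at h1
  have h2 : 0 ≤ F (s + 1) := by
    rw [hF]
    exact MeasureTheory.setIntegral_nonneg measurableSet_Ioi fun x hx =>
      inv_nonneg.2 (hfpos x (by have : s + 1 < x := hx; linarith)).le
  linarith

lemma hasDerivAt_tail_inverse {Finv : ℝ → ℝ} (hfc : ContinuousOn f (Ioi 0))
    (hfpos : ∀ s : ℝ, 0 < s → 0 < f s)
    (hdF : ∀ s > 0, HasDerivAt F (-(f s)⁻¹) s)
    (hFinv : ∀ s : ℝ, 0 < s → Finv (F s) = s) {s : ℝ} (hs : 0 < s) :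
    HasDerivAt Finv (-(f s)) (F s) := by
  have h1 : HasStrictDerivAt F (-(f s)⁻¹) s :=
    hasStrictDerivAt_of_hasDerivAt_of_continuousAt (f' := fun s => -(f s)⁻¹)
      (by filter_upwards [Ioi_mem_nhds hs] with x hx using hdF x hx)
      ((hfc.continuousAt (Ioi_mem_nhds hs)).inv₀ (hfpos s hs).ne').neg
  have h2 := h1.to_local_left_inverse (g := Finv)
    (neg_ne_zero.2 (inv_ne_zero (hfpos s hs).ne'))
    (by filter_upwards [Ioi_mem_nhds hs] with x hx using hFinv x hx)
  exact h2.hasDerivAt.congr_deriv (by rw [inv_neg, inv_inv])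

lemma eventually_le_tail_inverse {Finv φ : ℝ → ℝ} {b : ℝ} (hb : 0 < b)
    (hdF : ∀ s > 0, HasDerivAt F (-(f s)⁻¹) s) (hFpos : ∀ s > 0, 0 < F s)
    (hF0 : Tendsto F atTop (𝓝 0)) (hFinv : ∀ s : ℝ, 0 < s → Finv (F s) = s)
    (hφ : ∀ ρ : ℝ, φ ρ = Finv (Real.exp (-2 * ρ) / b)) (T : ℝ) :
    ∀ᶠ ρ in atTop, T ≤ φ ρ ∧ F (φ ρ) = Real.exp (-2 * ρ) / b := by
  wlog hT : 1 ≤ T generalizing T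
  · exact (this 1 le_rfl).mono fun ρ h => ⟨(not_le.1 hT).le.trans h.1, h.2⟩
  have hT0 : 0 < T := by linarith
  have hlim : Tendsto (fun ρ : ℝ => Real.exp (-2 * ρ) / b) atTop (𝓝 0) := by
    have : Tendsto (fun ρ : ℝ => -2 * ρ) atTop atBot :=
      tendsto_id.const_mul_atTop_of_neg (by norm_num)
    simpa using (Real.tendsto_exp_atBot.comp this).div_const b
  filter_upwards [hlim.eventually_lt_const (hFpos T hT0)] with ρ hρ
  have hy : 0 < Real.exp (-2 * ρ) / b := by positivity
  obtain ⟨U, hU, hTU⟩ := ((hF0.eventually_lt_const hy).and (eventually_ge_atTop T)).exists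
  obtain ⟨s, hs, hse⟩ := intermediate_value_Icc' hTU
    (fun x hx => (hdF x (hT0.trans_le hx.1)).continuousAt.continuousWithinAt) ⟨hU.le, hρ.le⟩
  have : φ ρ = s := by rw [hφ, ← hse, hFinv s (hT0.trans_le hs.1)]
  rw [this]
  exact ⟨hs.1, hse⟩

lemma tendsto_mul_tail_div (hdf : ∀ s > 0, HasDerivAt f (deriv f s) s)
    (hfpos : ∀ s : ℝ, 0 < s → 0 < f s)
    (hdF : ∀ s > 0, HasDerivAt F (-(f s)⁻¹) s)
    (hq1 : Tendsto (fun s => deriv f s * F s) atTop (𝓝 q)) :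
    Tendsto (fun s => f s * F s / s) atTop (𝓝 (q - 1)) := by
  have h1 := tendsto_div_id_of_deriv_tendsto_zero
    (G := fun s => f s * F s - (q - 1) * s) (G' := fun s => deriv f s * F s - q)
    (fun s hs => (((hdf s hs).mul (hdF s hs)).sub
      ((hasDerivAt_id s).const_mul (q - 1))).congr_deriv (by
        have := (hfpos s hs).ne'
        field_simp; ring))
    (by simpa using hq1.sub_const q)
  have h2 := h1.add_const (q - 1)
  rw [zero_add] at h2
  refine h2.congr' ?_
  filter_upwards [eventually_gt_atTop 0] with s hs
  field_simp
  ring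

lemma eventually_deriv_bounds (hfpos : ∀ s : ℝ, 0 < s → 0 < f s)
    (hf'pos : ∀ s : ℝ, 0 < s → 0 < deriv f s) (hFpos : ∀ s > 0, 0 < F s) (hq : 1 < q)
    (hq1 : Tendsto (fun s => deriv f s * F s) atTop (𝓝 q))
    (hq2 : Tendsto (fun s => (deriv f s) ^ 2 / (f s * deriv (deriv f) s)) atTop (𝓝 q))
    (hH : Tendsto (fun s => f s * F s / s) atTop (𝓝 (q - 1))) :
    ∃ P > 0, ∀ᶠ s in atTop, deriv f s ≤ P * f s / s ∧
      |deriv (deriv f) s| ≤ P * f s / s ^ 2 := by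
  set P₀ : ℝ := q / (q - 1) + 1 with hP₀
  have hq0 : 0 < q - 1 := by linarith
  have hP₀0 : 0 < P₀ := by positivity
  have hlim := hq1.div hH hq0.ne'
  refine ⟨max P₀ (2 / q * P₀ ^ 2), lt_max_of_lt_left hP₀0, ?_⟩
  filter_upwards [hlim.eventually_lt_const (lt_add_one _),
    hq2.eventually_const_lt (half_lt_self (by linarith : 0 < q)),
    eventually_gt_atTop 0] with s h1 h2 hs
  have hfs := hfpos s hs
  have hFs := hFpos s hs
  have hf's := hf'pos s hs
  have h3 : deriv f s ≤ P₀ * f s / s := by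
    have e : deriv f s * F s / (f s * F s / s) = deriv f s * s / f s := by field_simp
    simp only [Pi.div_apply, e] at h1
    rw [div_lt_iff₀ hfs] at h1
    rw [le_div_iff₀ hs]
    exact h1.le
  have hd2 : 0 < deriv (deriv f) s := by
    by_contra hneg
    have : (deriv f s) ^ 2 / (f s * deriv (deriv f) s) ≤ 0 :=
      div_nonpos_of_nonneg_of_nonpos (sq_nonneg _)
        (mul_nonpos_of_nonneg_of_nonpos hfs.le (not_lt.1 hneg))
    linarith
  refine ⟨h3.trans ?_, ?_⟩
  · gcongr; exact le_max_left _ _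
  · rw [abs_of_pos hd2]
    rw [lt_div_iff₀ (mul_pos hfs hd2)] at h2
    have h4 : (deriv f s) ^ 2 ≤ (P₀ * f s / s) ^ 2 := by gcongr
    have h5 : deriv (deriv f) s ≤ 2 / q * P₀ ^ 2 * f s / s ^ 2 := by
      have h6 : q / 2 * f s * deriv (deriv f) s ≤ q / 2 * f s *
          (2 / q * P₀ ^ 2 * f s / s ^ 2) := by
        calc _ ≤ (P₀ * f s / s) ^ 2 := by linarith
          _ = _ := by field_simp
      exact le_of_mul_le_mul_left h6 (by positivity)
    refine h5.trans ?_
    gcongr; exact le_max_right _ _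

/-- The Taylor remainder of `f`, rescaled, is uniformly quadratic and Lipschitz. -/
lemma eventually_remainder_bounds (hdf : ∀ s > 0, HasDerivAt f (deriv f s) s)
    (hddf : ∀ s > 0, HasDerivAt (deriv f) (deriv (deriv f) s) s)
    (hfpos : ∀ s : ℝ, 0 < s → 0 < f s)
    (hf'pos : ∀ s : ℝ, 0 < s → 0 < deriv f s) (hFpos : ∀ s > 0, 0 < F s) (hq : 1 < q)
    (hq1 : Tendsto (fun s => deriv f s * F s) atTop (𝓝 q))
    (hq2 : Tendsto (fun s => (deriv f s) ^ 2 / (f s * deriv (deriv f) s)) atTop (𝓝 q))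
    (hH : Tendsto (fun s => f s * F s / s) atTop (𝓝 (q - 1))) :
    ∃ K > 0, ∀ᶠ x in atTop, ∀ s, |s| ≤ 1 / 2 →
      |F x / x * (f (x * (1 + s)) - f x - deriv f x * x * s)| ≤ K * s ^ 2 ∧
      ∀ s', |s'| ≤ 1 / 2 →
        |F x / x * (f (x * (1 + s)) - f x - deriv f x * x * s) -
          F x / x * (f (x * (1 + s')) - f x - deriv f x * x * s')| ≤ K * |s - s'| := by
  obtain ⟨P, hP, hev⟩ := eventually_deriv_bounds hfpos hf'pos hFpos hq hq1 hq2 hH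
  obtain ⟨S, hS⟩ := eventually_atTop.1 (hev.and (eventually_gt_atTop 0))
  have hS0 : 0 < S := (hS S le_rfl).2
  set K : ℝ := 4 * P * Real.exp P * q with hK
  have hK0 : 0 < K := by positivity
  refine ⟨K, hK0, ?_⟩
  filter_upwards [eventually_ge_atTop (2 * S),
    hH.eventually_lt_const (by linarith : q - 1 < q)] with x hx hHx
  have hx0 : 0 < x := by linarith
  have hfx := hfpos x hx0
  have hFx := hFpos x hx0
  have hIcc : ∀ y ∈ Icc (x / 2) (3 * x / 2), S ≤ y ∧ 0 < y := fun y hy =>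
    ⟨by linarith [hy.1], by linarith [hy.1]⟩
  have hdouble : ∀ y ∈ Icc (x / 2) (3 * x / 2), f y ≤ Real.exp P * f x := by
    intro y hy
    rcases le_total y x with hyx | hxy
    · have hmono : MonotoneOn f (Ioi 0) := monotoneOn_of_deriv_nonneg (convex_Ioi 0)
        (fun z hz => (hdf z hz).continuousAt.continuousWithinAt)
        (fun z hz => (hdf z (interior_subset hz)).differentiableAt.differentiableWithinAt)
        (fun z hz => (hf'pos z (interior_subset hz)).le)
      exact (hmono (hIcc y hy).2 hx0 hyx).trans
        (le_mul_of_one_le_left hfx.le (Real.one_le_exp hP.le))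
    · have h1 : ‖Real.log (f y) - Real.log (f x)‖ ≤ P / x * ‖y - x‖ :=
        (convex_Icc x y).norm_image_sub_le_of_norm_hasDerivWithin_le
          (f' := fun z => deriv f z / f z)
          (fun z hz => ((hdf z (hx0.trans_le hz.1)).log
            (hfpos z (hx0.trans_le hz.1)).ne').hasDerivWithinAt)
          (fun z hz => by
            have hz0 := hx0.trans_le hz.1
            have hfz := hfpos z hz0
            rw [Real.norm_of_nonneg (div_pos (hf'pos z hz0) hfz).le, div_le_iff₀ hfz]
            refine (hS z (by linarith [hz.1])).1.1.trans ?_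
            rw [div_mul_eq_mul_div]
            gcongr
            exact hz.1) (left_mem_Icc.2 hxy) (right_mem_Icc.2 hxy)
      rw [Real.norm_of_nonneg (sub_nonneg.2 hxy)] at h1
      have h2 : P / x * (y - x) ≤ P := by
        rw [div_mul_eq_mul_div, div_le_iff₀ hx0]
        exact mul_le_mul_of_nonneg_left (by linarith [hy.2]) hP.le
      have h3 : Real.log (f y) ≤ P + Real.log (f x) := by
        have := (le_abs_self _).trans h1
        linarith
      have h4 := Real.exp_le_exp.2 h3
      rwa [Real.exp_add, Real.exp_log hfx, Real.exp_log (hfpos y (hIcc y hy).2)] at h4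
  have hmem : ∀ s : ℝ, |s| ≤ 1 / 2 → x * (1 + s) ∈ Icc (x / 2) (3 * x / 2) := fun s hs => by
    have := abs_le.1 hs
    constructor <;> nlinarith
  have hf' : ∀ y ∈ Icc (x / 2) (3 * x / 2),
      |deriv f y - deriv f x| ≤ 4 * P * Real.exp P * f x / x ^ 2 * |y - x| := by
    intro y hy
    refine (convex_Icc (x / 2) (3 * x / 2)).norm_image_sub_le_of_norm_hasDerivWithin_le
      (f' := deriv (deriv f)) (fun z hz => (hddf z (hIcc z hz).2).hasDerivWithinAt)
      (fun z hz => ?_) ⟨by linarith, by linarith⟩ hy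
    have hz0 := (hIcc z hz).2
    refine (hS z (hIcc z hz).1).1.2.trans ?_
    calc P * f z / z ^ 2 ≤ P * (Real.exp P * f x) / (x / 2) ^ 2 := by
          gcongr
          · exact hdouble z hz
          · exact hz.1
      _ = _ := by field_simp; ring
  set R : ℝ → ℝ := fun s => F x / x * (f (x * (1 + s)) - f x - deriv f x * x * s) with hR
  have hRd : ∀ s, |s| ≤ 1 / 2 → HasDerivAt R (F x * (deriv f (x * (1 + s)) - deriv f x)) s := by
    intro s hs
    have h1 : HasDerivAt (fun s => x * (1 + s)) x s := by
      simpa using ((hasDerivAt_id s).const_add 1).const_mul x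
    have h2 := (hdf _ (hIcc _ (hmem s hs)).2).comp s h1
    refine ((((h2.sub_const (f x)).sub
      ((hasDerivAt_id s).const_mul (deriv f x * x)))).const_mul (F x / x)).congr_deriv ?_
    field_simp
  have hRb : ∀ s, |s| ≤ 1 / 2 → |F x * (deriv f (x * (1 + s)) - deriv f x)| ≤ K * |s| := by
    intro s hs
    rw [abs_mul, abs_of_pos hFx]
    have h1 := hf' _ (hmem s hs)
    have e : x * (1 + s) - x = x * s := by ring
    rw [e, abs_mul, abs_of_pos hx0] at h1
    calc _ ≤ F x * (4 * P * Real.exp P * f x / x ^ 2 * (x * |s|)) := by gcongr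
      _ = 4 * P * Real.exp P * (f x * F x / x) * |s| := by field_simp
      _ ≤ 4 * P * Real.exp P * q * |s| := by gcongr
  intro s hs
  refine ⟨?_, fun s' hs' => ?_⟩
  · have h1 := (convex_Icc (-|s|) |s|).norm_image_sub_le_of_norm_hasDerivWithin_le (f := R)
      (C := K * |s|)
      (fun z hz => (hRd z ((abs_le.2 hz).trans hs)).hasDerivWithinAt)
      (fun z hz => (hRb z ((abs_le.2 hz).trans hs)).trans
        (mul_le_mul_of_nonneg_left (abs_le.2 hz) hK0.le))
      (abs_le.1 (by simp : |(0 : ℝ)| ≤ |s|)) (abs_le.1 le_rfl : s ∈ Icc (-|s|) |s|)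
    have hR0 : R 0 = 0 := by simp [hR]
    rw [hR0, sub_zero, sub_zero, Real.norm_eq_abs, Real.norm_eq_abs, mul_assoc, abs_mul_abs_self,
      ← sq] at h1
    exact h1
  · exact (convex_Icc (-(1 / 2 : ℝ)) (1 / 2)).norm_image_sub_le_of_norm_hasDerivWithin_le (f := R)
      (fun z hz => (hRd z (abs_le.2 hz)).hasDerivWithinAt)
      (fun z hz => (hRb z (abs_le.2 hz)).trans
        (mul_le_of_le_one_right hK0.le ((abs_le.2 hz).trans (by norm_num))))
      (abs_le.1 hs') (abs_le.1 hs)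

end Nonlinearity

lemma exponent_bounds {N : ℕ} (hN : 3 ≤ N) {q pf : ℝ} (hpf : pf = q / (q - 1))
    (hpc : (N : ℝ) / ((N : ℝ) - 2) < pf) (hpS : pf < ((N : ℝ) + 2) / ((N : ℝ) - 2)) :
    1 < q ∧ pf - 1 = 1 / (q - 1) ∧ 2 * q < N ∧ (N : ℝ) + 2 < 4 * q := by
  have hN3 : (3 : ℝ) ≤ N := by exact_mod_cast hN
  have hN2 : (0 : ℝ) < N - 2 := by linarith
  have hpf1 : 1 < pf := lt_trans (by rw [lt_div_iff₀ hN2]; linarith) hpc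
  have hq1 : q - 1 ≠ 0 := fun h => by
    rw [hpf, h, div_zero] at hpf1
    linarith
  have hsub : pf - 1 = 1 / (q - 1) := by
    rw [hpf]
    field_simp
    ring
  have hq : 0 < q - 1 := one_div_pos.1 (hsub ▸ sub_pos.2 hpf1)
  rw [hpf, div_lt_div_iff₀ hN2 hq] at hpc
  rw [hpf, div_lt_div_iff₀ hq hN2] at hpS
  exact ⟨by linarith, hsub, by linarith, by linarith⟩

lemma exists_linearBound_Qker {N : ℕ} (hN : 3 ≤ N) {q pf a b : ℝ} (hq : 1 < q)
    (hpf : pf - 1 = 1 / (q - 1)) (ha : a = 4 * q - N - 2) (hb : b = 2 * N - 4 * q)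
    (ha0 : 0 < a) (hb0 : 0 < b) :
    ∃ lam > 0, ∃ θ ∈ Icc (0 : ℝ) 1, ∃ M > 0, LinearBound a b lam θ M ∧
      ∀ ρ τ, Qker N pf a b ρ τ = (1 + θ * (ρ - τ)) * Real.exp (-lam * (ρ - τ)) := by
  have hN3 : (3 : ℝ) ≤ N := by exact_mod_cast hN
  set s : ℝ := Real.sqrt ((N : ℝ) - 1) with hs
  have hs1 : 1 < s := by rw [hs, Real.lt_sqrt zero_le_one]; linarith
  have hss : s ^ 2 = N - 1 := Real.sq_sqrt (by linarith)
  have hD : 0 < (N : ℝ) - 4 + 2 * s := by linarith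
  have hq0 : 0 < q - 1 := by linarith
  have hdisc : a ^ 2 - 4 * b = (4 * q - N - 2 * s) * (4 * q - N + 2 * s) := by
    rw [ha, hb]
    linear_combination 4 * hss
  have hpos : 0 < 4 * q - N + 2 * s := by linarith
  have hstar : pStar N - 1 = 4 / ((N : ℝ) - 4 + 2 * s) := by rw [pStar]; ring
  have hlt : pf < pStar N ↔ (N : ℝ) + 2 * s < 4 * q := by
    rw [← sub_lt_sub_iff_right 1, hpf, hstar, div_lt_div_iff₀ hq0 hD]
    constructor <;> intro h <;> linarith
  have heq : pf = pStar N ↔ (N : ℝ) + 2 * s = 4 * q := by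
    rw [← sub_left_inj (a := 1), hpf, hstar, div_eq_div_iff hq0.ne' hD.ne']
    constructor <;> intro h <;> linarith
  rcases lt_trichotomy ((N : ℝ) + 2 * s) (4 * q) with h | h | h
  · have hd : 0 < a ^ 2 - 4 * b := by
      rw [hdisc]
      exact mul_pos (by linarith) hpos
    set r := Real.sqrt (a ^ 2 - 4 * b) with hr
    have hr0 : 0 < r := Real.sqrt_pos.2 hd
    have hrr : r ^ 2 = a ^ 2 - 4 * b := Real.sq_sqrt hd.le
    have hra : r < a := by nlinarith
    have hlam : 0 < lamOneRoot a b := by rw [lamOneRoot]; linarith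
    obtain ⟨M, hM, hL⟩ := linearBound_of_real_roots (a := a) (b := b) (lam := lamOneRoot a b)
      (θ := 0) (mu := (a + r) / 2) hlam (by rw [lamOneRoot]; linarith)
      (by rw [lamOneRoot]; linarith) (by rw [lamOneRoot]; ring)
      (by rw [lamOneRoot]; linear_combination - hrr / 4)
    refine ⟨_, hlam, 0, by simp, M, hM, hL, fun ρ τ => ?_⟩
    rw [Qker, if_pos (hlt.2 h)]
    simp
  · have hd : a ^ 2 = 4 * b := by
      rw [← sub_eq_zero, hdisc, ← h]
      ring
    obtain ⟨M, hM, hL⟩ := linearBound_of_real_roots (a := a) (b := b) (lam := a / 2) (θ := 1)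
      (mu := a / 2) (half_pos ha0) le_rfl (by norm_num) (by ring) (by linear_combination hd / 4)
    refine ⟨_, half_pos ha0, 1, by simp, M, hM, hL, fun ρ τ => ?_⟩
    rw [Qker, if_neg (mt hlt.1 h.not_lt), if_pos (heq.2 h), one_mul]
  · have hd : a ^ 2 < 4 * b := by
      rw [← sub_neg, hdisc]
      exact mul_neg_of_neg_of_pos (by linarith) hpos
    obtain ⟨M, hM, hL⟩ := linearBound_of_complex_roots (θ := 0) ha0 hd
    refine ⟨_, half_pos ha0, 0, by simp, M, hM, hL, fun ρ τ => ?_⟩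
    rw [Qker, if_neg (mt hlt.1 h.not_gt), if_neg (mt heq.1 h.ne')]
    simp

end TransformedEquation

open Set Filter Topology in
/-- Theorem 3.1: for `p_c < p_f < p_S`, the transformed equation
`η'' + aη' + bη + I + L₁η + L₂η' + N[η] = 0` on `[ρ₀,∞)` admits, for all small
`α, β > 0`, a `C²` solution with `η(ρ₀) = α`, `η'(ρ₀) = β` and
`|η(ρ)| + |η'(ρ)| ≤ C(Q(ρ,ρ₀) + ∫_{ρ₀}^{ρ} Q(ρ,τ)|I(τ)| dτ)`. -/
theorem transformed_equation_multiplicity (N : ℕ) (hN : 3 ≤ N)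
    (f F Finv : ℝ → ℝ) (q pf a b : ℝ)
    (hf : ContDiffOn ℝ 2 f (Set.Ioi 0))
    (hfpos : ∀ s : ℝ, 0 < s → 0 < f s)
    (hf'pos : ∀ s : ℝ, 0 < s → 0 < deriv f s)
    (hfint : ∀ s : ℝ, 0 < s →
      MeasureTheory.IntegrableOn (fun t => (f t)⁻¹) (Set.Ioi s))
    (hF : ∀ s : ℝ, F s = ∫ t in Set.Ioi s, (f t)⁻¹)
    (hFinv : ∀ s : ℝ, 0 < s → Finv (F s) = s)
    (hq2 : Filter.Tendsto (fun s => (deriv f s) ^ 2 / (f s * deriv (deriv f) s))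
      Filter.atTop (nhds q))
    (hq1 : Filter.Tendsto (fun s => deriv f s * F s) Filter.atTop (nhds q))
    (hpf : pf = q / (q - 1))
    (ha : a = 4 / (pf - 1) - (N : ℝ) + 2)
    (hb : b = 2 * (N : ℝ) - 4 * q)
    (hpc : (N : ℝ) / ((N : ℝ) - 2) < pf)
    (hpS : pf < ((N : ℝ) + 2) / ((N : ℝ) - 2))
    (φ Ifun L₁ L₂ : ℝ → ℝ)
    (hφ : ∀ ρ : ℝ, φ ρ = Finv (Real.exp (-2 * ρ) / b))
    (hI : ∀ ρ : ℝ, Ifun ρ =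
      4 * (f (φ ρ) * F (φ ρ) / φ ρ) * (deriv f (φ ρ) * F (φ ρ) - q))
    (hL₁ : ∀ ρ : ℝ, L₁ ρ =
      b * ((deriv f (φ ρ) * F (φ ρ) - q) -
        (f (φ ρ) * F (φ ρ) / φ ρ - 1 / (pf - 1))) + Ifun ρ)
    (hL₂ : ∀ ρ : ℝ, L₂ ρ =
      4 * (f (φ ρ) * F (φ ρ) / φ ρ - 1 / (pf - 1))) :
    ∃ ρ₀ : ℝ, 0 < ρ₀ ∧ ∃ ε : ℝ, 0 < ε ∧ ∃ C : ℝ, 0 < C ∧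
      ∀ α β : ℝ, 0 < α → 0 < β → α + β < ε →
        ∃ η η' η'' : ℝ → ℝ,
          (∀ ρ ∈ Set.Ici ρ₀, HasDerivWithinAt η (η' ρ) (Set.Ici ρ₀) ρ) ∧
          (∀ ρ ∈ Set.Ici ρ₀, HasDerivWithinAt η' (η'' ρ) (Set.Ici ρ₀) ρ) ∧
          ContinuousOn η'' (Set.Ici ρ₀) ∧
          η ρ₀ = α ∧ η' ρ₀ = β ∧
          (∀ ρ ≥ ρ₀,
            η'' ρ + a * η' ρ + b * η ρ + Ifun ρ + L₁ ρ * η ρ + L₂ ρ * η' ρ +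
              b * (F (φ ρ) / φ ρ) *
                (f (φ ρ * (1 + η ρ)) - f (φ ρ) - deriv f (φ ρ) * φ ρ * η ρ)
              = 0) ∧
          (∀ ρ ≥ ρ₀,
            |η ρ| + |η' ρ| ≤
              C * (Qker N pf a b ρ ρ₀ +
                ∫ τ in ρ₀..ρ, Qker N pf a b ρ τ * |Ifun τ|)) := by

  have hIoi : ∀ s > 0, Ioi (0 : ℝ) ∈ 𝓝 s := fun s hs => Ioi_mem_nhds hs
  have hfc : ContinuousOn f (Ioi 0) := hf.continuousOn
  have hdf : ∀ s > 0, HasDerivAt f (deriv f s) s := fun s hs =>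
    ((hf.contDiffAt (hIoi s hs)).differentiableAt (by norm_num)).hasDerivAt
  have hf' : ContDiffOn ℝ 1 (deriv f) (Ioi 0) := hf.deriv_of_isOpen isOpen_Ioi (by norm_num)
  have hddf : ∀ s > 0, HasDerivAt (deriv f) (deriv (deriv f) s) s := fun s hs =>
    ((hf'.contDiffAt (hIoi s hs)).differentiableAt (by norm_num)).hasDerivAt
  have hdF : ∀ s > 0, HasDerivAt F (-(f s)⁻¹) s := fun s hs =>
    hasDerivAt_tail hfc hfpos hfint hF hs
  have hFpos : ∀ s > 0, 0 < F s := fun s hs => tail_pos hfc hfpos hfint hF hs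
  have hF0 : Tendsto F atTop (𝓝 0) :=
    (MeasureTheory.tendsto_integral_Ioi_zero tendsto_id).congr fun s => (hF s).symm
  obtain ⟨hq, hpf1, hqN, hNq⟩ := exponent_bounds hN hpf hpc hpS
  have hq0 : 0 < q - 1 := by linarith
  have hb0 : 0 < b := by linarith
  have ha' : a = 4 * q - N - 2 := by
    rw [ha, hpf1]
    field_simp
    ring
  have hpf1' : 1 / (pf - 1) = q - 1 := by rw [hpf1, one_div_one_div]
  obtain ⟨lam, hlam, θ, hθ, M, hM, hlin, hQ⟩ :=
    exists_linearBound_Qker hN hq hpf1 ha' hb (by linarith) hb0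
  have hH := tendsto_mul_tail_div hdf hfpos hdF hq1
  obtain ⟨KN, hKN, hrem⟩ := eventually_remainder_bounds hdf hddf hfpos hf'pos hFpos hq hq1 hq2 hH
  set K : ℝ := b / (2 * (q - 1)) + b + 5 + b * KN with hK
  have hK0 : 0 < K := by positivity
  obtain ⟨σ, hσ, hsol⟩ := exists_small_solution hlam hq0 hK0 hθ.1 hθ.2 hM hlin
  have hH0 : Tendsto (fun s => f s * F s / s - (q - 1)) atTop (𝓝 0) := by
    simpa using hH.sub_const (q - 1)
  have hI0 : Tendsto (fun s => 4 * (f s * F s / s) * (deriv f s * F s - q)) atTop (𝓝 0) := by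
    simpa using (hH.const_mul 4).mul (hq1.sub_const q)
  have hsmall : ∀ {y : ℝ → ℝ}, Tendsto y atTop (𝓝 0) → ∀ᶠ s in atTop, |y s| ≤ σ := fun hy =>
    ((Metric.tendsto_nhds.1 hy σ hσ).mono fun s hs => by simpa using hs.le)
  obtain ⟨T, hT⟩ := eventually_atTop.1 (((hsmall hH0).and (hsmall hI0)).and
    ((hH.eventually_const_le (half_lt_self hq0)).and (hrem.and (eventually_gt_atTop 0))))
  obtain ⟨ρ₁, hρ₁⟩ := eventually_atTop.1
    (eventually_le_tail_inverse hb0 hdF hFpos hF0 hFinv hφ T)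
  set ρ₀ : ℝ := max ρ₁ 1 with hρ₀
  have hφT : ∀ ρ ≥ ρ₀, T ≤ φ ρ ∧ F (φ ρ) = Real.exp (-2 * ρ) / b := fun ρ hρ =>
    hρ₁ ρ ((le_max_left _ _).trans hρ)
  have hφ0 : ∀ ρ ≥ ρ₀, 0 < φ ρ := fun ρ hρ => (hT _ (hφT ρ hρ).1).2.2.2
  have hdφ : ∀ ρ ≥ ρ₀, HasDerivAt φ (2 * f (φ ρ) * F (φ ρ)) ρ := fun ρ hρ => by
    have h1 : HasDerivAt (fun ρ : ℝ => Real.exp (-2 * ρ) / b) (-2 * F (φ ρ)) ρ :=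
      ((((hasDerivAt_id ρ).const_mul (-2)).exp).div_const b).congr_deriv (by
        rw [(hφT ρ hρ).2]; simp; ring)
    have h2 := hasDerivAt_tail_inverse hfc hfpos hdF hFinv (hφ0 ρ hρ)
    rw [(hφT ρ hρ).2] at h2
    exact ((h2.comp ρ h1).congr_of_eventuallyEq (.of_forall hφ)).congr_deriv (by ring)
  set ψ : ℝ → ℝ := fun t => φ (max t ρ₀) with hψ
  have hψφ : ∀ t ≥ ρ₀, ψ t = φ t := fun t ht => by rw [hψ]; simp only [max_eq_left ht]
  have hψ0 : ∀ t, 0 < ψ t := fun t => hφ0 _ (le_max_right _ _)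
  have hψT := fun t => hT (ψ t) (hφT _ (le_max_right t ρ₀)).1
  have hψc : Continuous ψ :=
    ContinuousOn.comp_continuous (s := Ici ρ₀)
      (fun t ht => (hdφ t ht).continuousAt.continuousWithinAt)
      (continuous_id.max continuous_const) fun t => mem_Ici.2 (le_max_right t ρ₀)
  have hfψ : Continuous fun t => f (ψ t) := hfc.comp_continuous hψc hψ0
  have hf'ψ : Continuous fun t => deriv f (ψ t) := hf'.continuousOn.comp_continuous hψc hψ0
  have hFψ : Continuous fun t => F (ψ t) :=
    ContinuousOn.comp_continuous (s := Ioi 0)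
      (fun t ht => (hdF t ht).continuousAt.continuousWithinAt) hψc hψ0
  set H : ℝ → ℝ := fun t => f (ψ t) * F (ψ t) / ψ t with hHdef
  have hHc : Continuous H := (hfψ.mul hFψ).div hψc fun t => (hψ0 t).ne'
  set g : ℝ → ℝ := fun t => deriv f (ψ t) * F (ψ t) - q with hg
  have hgc : Continuous g := (hf'ψ.mul hFψ).sub continuous_const
  set I : ℝ → ℝ := fun t => 4 * H t * g t with hIdef
  have hIc : Continuous I := (hHc.const_mul 4).mul hgc
  have hIeq : ∀ t ≥ ρ₀, Ifun t = I t := fun t ht => by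
    rw [hI, ← hψφ t ht]
  set c : ℝ → ℝ := fun s => max (-(1 / 2)) (min s (1 / 2)) with hc
  have hcc : Continuous c := continuous_const.max (continuous_id.min continuous_const)
  have hc1 : ∀ s, |c s| ≤ 1 / 2 := fun s => abs_clamp_le (by norm_num)
  set Nl : ℝ → ℝ → ℝ := fun t s => b * (F (ψ t) / ψ t * (f (ψ t * (1 + c s)) - f (ψ t) -
    deriv f (ψ t) * ψ t * c s)) with hNl
  have hNc : Continuous (Function.uncurry Nl) := by
    have h1 : Continuous fun p : ℝ × ℝ => f (ψ p.1 * (1 + c p.2)) :=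
      hfc.comp_continuous (by fun_prop) fun p => mul_pos (hψ0 _) (by
        linarith [(abs_le.1 (hc1 p.2)).1])
    have h2 : Continuous fun p : ℝ × ℝ => F (ψ p.1) / ψ p.1 :=
      (hFψ.comp continuous_fst).div (hψc.comp continuous_fst) fun p => (hψ0 _).ne'
    have h3 : Continuous fun p : ℝ × ℝ => f (ψ p.1) := hfψ.comp continuous_fst
    have h4 : Continuous fun p : ℝ × ℝ => deriv f (ψ p.1) := hf'ψ.comp continuous_fst
    have h5 : Continuous fun p : ℝ × ℝ => ψ p.1 := hψc.comp continuous_fst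
    have h6 : Continuous fun p : ℝ × ℝ => c p.2 := hcc.comp continuous_snd
    exact (h2.mul ((h1.sub h3).sub ((h4.mul h5).mul h6))).const_mul b
  have hHlow : ∀ t, (q - 1) / 2 ≤ H t := fun t => (hψT t).2.1
  have hgI : ∀ t, |g t| ≤ |I t| / (2 * (q - 1)) := fun t => by
    have h1 : 0 ≤ H t := (half_pos hq0).le.trans (hHlow t)
    rw [le_div_iff₀ (by positivity), hIdef]
    simp only
    rw [abs_mul, abs_of_nonneg (by positivity : 0 ≤ 4 * H t), mul_comm]
    exact mul_le_mul_of_nonneg_right (by linarith [hHlow t]) (abs_nonneg _)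
  have hψd : ∀ t ∈ Ici ρ₀, HasDerivWithinAt ψ (2 * H t * ψ t) (Ici ρ₀) t := fun t ht => by
    refine ((hdφ t ht).hasDerivWithinAt.congr hψφ (hψφ t ht)).congr_deriv ?_
    rw [hHdef, ← hψφ t ht]
    have := (hψ0 t).ne'
    field_simp
  have hKI : b / (2 * (q - 1)) + b + 1 ≤ K := by
    rw [hK]
    have : 0 < b * KN := by positivity
    linarith
  have hK4 : 4 ≤ K := by
    rw [hK]
    have : 0 < b * KN := by positivity
    have : 0 < b / (2 * (q - 1)) := by positivity
    linarith
  have hKb : b * KN ≤ K := by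
    rw [hK]
    have : 0 < b / (2 * (q - 1)) := by positivity
    linarith
  have hKb' : b ≤ K := by
    have : 0 < b / (2 * (q - 1)) := by positivity
    linarith
  have hsol' := hsol ρ₀ I (fun t => b * (g t - (H t - (q - 1))) + I t)
    (fun t => 4 * (H t - (q - 1))) (fun t => H t - (q - 1)) (fun t => 2 * H t) ψ Nl hIc
    (((hgc.sub (hHc.sub continuous_const)).const_mul b).add hIc)
    ((hHc.sub continuous_const).const_mul 4) hNc
    (fun t _ => (hψT t).1.2) (hψT ρ₀).1.1 (fun t _ => hψ0 t)
    (fun t _ => by linarith [hHlow t]) hψd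
    (fun t ht => by
      have hd := (((hdf _ (hψ0 t)).mul (hdF _ (hψ0 t))).div (hasDerivAt_id _)
        (hψ0 t).ne').comp_hasDerivWithinAt t (hψd t ht)
      refine (hd.sub_const (q - 1)).congr_deriv ?_
      have h1 := (hψ0 t).ne'
      have h2 := (hfpos _ (hψ0 t)).ne'
      simp only [hIdef, hg, hHdef, Pi.mul_apply, id]
      field_simp
      ring)
    (fun t _ => by
      have h1 := abs_add_le (b * (g t - (H t - (q - 1)))) (I t)
      have h2 := abs_sub (g t) (H t - (q - 1))
      rw [abs_mul, abs_of_pos hb0] at h1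
      have h3 := mul_le_mul_of_nonneg_left (h2.trans (add_le_add_left (hgI t) _)) hb0.le
      have h4 := mul_le_mul_of_nonneg_right hKI (abs_nonneg (I t))
      have h5 := mul_le_mul_of_nonneg_right hKb' (abs_nonneg (H t - (q - 1)))
      have h6 := mul_nonneg hb0.le (abs_nonneg (I t))
      have h7 : b * (|I t| / (2 * (q - 1))) = b / (2 * (q - 1)) * |I t| := by ring
      linarith)
    (fun t _ => by
      rw [abs_mul, abs_of_pos (by norm_num : (0 : ℝ) < 4)]
      have h1 := mul_nonneg hK0.le (abs_nonneg (I t))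
      have h2 := mul_le_mul_of_nonneg_right hK4 (abs_nonneg (H t - (q - 1)))
      linarith)
    (fun t _ s hs => by
      have h1 := ((hψT t).2.2.1 (c s) (hc1 s)).1
      rw [hNl]
      simp only
      rw [abs_mul, abs_of_pos hb0]
      rw [show c s = s from clamp_eq_self hs] at h1 ⊢
      calc _ ≤ b * (KN * s ^ 2) := mul_le_mul_of_nonneg_left h1 hb0.le
        _ = b * KN * s ^ 2 := by ring
        _ ≤ _ := mul_le_mul_of_nonneg_right hKb (sq_nonneg s))
    (fun t _ s s' => by
      have h1 := ((hψT t).2.2.1 (c s) (hc1 s)).2 (c s') (hc1 s')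
      rw [hNl]
      simp only
      rw [← mul_sub, abs_mul, abs_of_pos hb0]
      calc _ ≤ b * (KN * |c s - c s'|) := mul_le_mul_of_nonneg_left h1 hb0.le
        _ ≤ b * (KN * |s - s'|) := by
          have := abs_clamp_sub_clamp_le (1 / 2) s s'
          gcongr
        _ = b * KN * |s - s'| := by ring
        _ ≤ _ := mul_le_mul_of_nonneg_right hKb (abs_nonneg _))
  refine ⟨ρ₀, zero_lt_one.trans_le (le_max_right _ _), σ / M, div_pos hσ hM, M * (1 + σ),
    by positivity, fun α β hα hβ hαβ => ?_⟩
  rw [lt_div_iff₀' hM] at hαβ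
  obtain ⟨η, η', hηc, hη'c, hη0, hη'0, hηs, hηd, hη'd, hηb⟩ :=
    hsol' α β (by rw [abs_of_pos hα, abs_of_pos hβ]; exact hαβ.le)
  refine ⟨η, η', _, fun t ht => (hηd t ht).hasDerivWithinAt,
    fun t ht => (hη'd t ht).hasDerivWithinAt, Continuous.continuousOn ?_, hη0, hη'0,
    fun t ht => ?_, fun t ht => ?_⟩
  · have h1 : Continuous fun t => Nl t (η t) := hNc.comp (continuous_id.prodMk hηc)
    fun_prop
  · have h1 : c (η t) = η t := clamp_eq_self (hηs t ht)
    rw [hL₁, hL₂, hpf1', hIeq t ht, ← hψφ t ht]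
    simp only [hNl, h1]
    ring
  · refine (hηb t ht).trans_eq ?_
    rw [hQ]
    congr 2
    refine intervalIntegral.integral_congr fun τ hτ => ?_
    rw [uIcc_of_le ht] at hτ
    simp only [hQ, hIeq τ hτ.1]
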